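/- arXiv:2202.06560 — 3 statements merged into one kernel-verified Lean document; each statement's English description precedes it below -/
import Mathlib

section
/- In the coordinate hypersurface-variation setup, define the covariant t-derivative of the normal family by (Dn_t/Dt)^μ := ∂_t n_t^μ + Σ_{λ,σ} Γ^μ_{λσ}(φ_t) ∂_tφ_t^λ n_t^σ. Then at t = 0 and at every y ∈ U, (Dn_t/Dt)^μ|_{t=0} = Σ_{a,b} ∂_aφ₀^μ h^{ab} ( −ϵ ∂_b f + Σ_c K_{bc} X^c ), i.e. the variation of the unit normal equals Tφ₀ applied to −ϵ grad^Σ f + (i_X K)^{♯_h}. -/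
noncomputable section

/-- The partial derivative `∂_a f` of a function on `ℝ^N` in the `a`-th coordinate
direction. -/
def pder {N : ℕ} (f : (Fin N → ℝ) → ℝ) (a : Fin N) (x : Fin N → ℝ) : ℝ :=
  fderiv ℝ f x (Pi.single a 1)

/-- The pointwise inverse components `g^{μν}` of a metric given in components. -/
def ginv {N : ℕ} (g : (Fin N → ℝ) → Fin N → Fin N → ℝ) (x : Fin N → ℝ)
    (μ ν : Fin N) : ℝ :=
  (Matrix.of (g x))⁻¹ μ ν

/-- The Christoffel symbols
`Γ^l_{μν} = (1/2) Σ_σ g^{lσ} (∂_μ g_{σν} + ∂_ν g_{σμ} − ∂_σ g_{μν})` of the metric `g`. -/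
def christoffel {N : ℕ} (g : (Fin N → ℝ) → Fin N → Fin N → ℝ) (x : Fin N → ℝ)
    (l μ ν : Fin N) : ℝ :=
  (1 / 2) * ∑ σ, ginv g x l σ *
    (pder (fun z => g z σ ν) μ x + pder (fun z => g z σ μ) ν x
      - pder (fun z => g z μ ν) σ x)

/-- The spatial derivative `∂_a φ_t^μ` of the hypersurface family. -/
def Dphi {n : ℕ} (φ : ℝ → (Fin n → ℝ) → Fin (n + 1) → ℝ) (t : ℝ) (y : Fin n → ℝ)
    (a : Fin n) (μ : Fin (n + 1)) : ℝ :=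
  pder (fun z => φ t z μ) a y

/-- The induced metric `(h_t)_{ab} = Σ_{μν} g_{μν}(φ_t) ∂_aφ_t^μ ∂_bφ_t^ν`. -/
def indMet {n : ℕ} (g : (Fin (n + 1) → ℝ) → Fin (n + 1) → Fin (n + 1) → ℝ)
    (φ : ℝ → (Fin n → ℝ) → Fin (n + 1) → ℝ) (t : ℝ) (y : Fin n → ℝ)
    (a b : Fin n) : ℝ :=
  ∑ μ, ∑ ν, g (φ t y) μ ν * Dphi φ t y a μ * Dphi φ t y b ν

/-- The inverse `(h_t)^{ab}` of the induced metric. -/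
def indMetInv {n : ℕ} (g : (Fin (n + 1) → ℝ) → Fin (n + 1) → Fin (n + 1) → ℝ)
    (φ : ℝ → (Fin n → ℝ) → Fin (n + 1) → ℝ) (t : ℝ) (y : Fin n → ℝ)
    (a b : Fin n) : ℝ :=
  (Matrix.of (fun a b => indMet g φ t y a b))⁻¹ a b

/-- The extrinsic curvature
`(K_t)_{ab} = Σ_{μν} g_{μν}(φ_t) ∂_aφ_t^μ (∂_b n_t^ν + Σ_{lσ} Γ^ν_{lσ}(φ_t) ∂_bφ_t^l n_t^σ)`. -/
def extK {n : ℕ} (g : (Fin (n + 1) → ℝ) → Fin (n + 1) → Fin (n + 1) → ℝ)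
    (φ nrm : ℝ → (Fin n → ℝ) → Fin (n + 1) → ℝ) (t : ℝ) (y : Fin n → ℝ)
    (a b : Fin n) : ℝ :=
  ∑ μ, ∑ ν, g (φ t y) μ ν * Dphi φ t y a μ *
    (pder (fun z => nrm t z ν) b y
      + ∑ l, ∑ σ, christoffel g (φ t y) ν l σ * Dphi φ t y b l * nrm t y σ)

/-- The trace `k_t = (h_t)^{ab} (K_t)_{ab}` of the extrinsic curvature. -/
def trExtK {n : ℕ} (g : (Fin (n + 1) → ℝ) → Fin (n + 1) → Fin (n + 1) → ℝ)
    (φ nrm : ℝ → (Fin n → ℝ) → Fin (n + 1) → ℝ) (t : ℝ) (y : Fin n → ℝ) : ℝ :=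
  ∑ a, ∑ b, indMetInv g φ t y a b * extK g φ nrm t y a b

/-- The Riemann curvature components
`R^l_{αμβ} = ∂_μ Γ^l_{αβ} − ∂_β Γ^l_{αμ} + Σ_σ (Γ^l_{σμ} Γ^σ_{αβ} − Γ^l_{σβ} Γ^σ_{αμ})`. -/
def riemann {N : ℕ} (g : (Fin N → ℝ) → Fin N → Fin N → ℝ) (x : Fin N → ℝ)
    (l α μ β : Fin N) : ℝ :=
  pder (fun z => christoffel g z l α β) μ x
    - pder (fun z => christoffel g z l α μ) β x
    + ∑ σ, (christoffel g x l σ μ * christoffel g x σ α β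
        - christoffel g x l σ β * christoffel g x σ α μ)

/-- The lowered Riemann tensor `R_{μανβ} = Σ_l g_{μl} R^l_{ανβ}`. -/
def riemannLow {N : ℕ} (g : (Fin N → ℝ) → Fin N → Fin N → ℝ) (x : Fin N → ℝ)
    (μ α ν β : Fin N) : ℝ :=
  ∑ l, g x μ l * riemann g x l α ν β

/-- The Ricci tensor `Ric_{αβ} = Σ_l R^l_{αlβ}`. -/
def ricci {N : ℕ} (g : (Fin N → ℝ) → Fin N → Fin N → ℝ) (x : Fin N → ℝ)
    (α β : Fin N) : ℝ :=
  ∑ l, riemann g x l α l β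

/-- The Christoffel symbols `Γ^{Σ,c}_{ab}` of the induced metric `h₀`. -/
def christoffelInd {n : ℕ} (g : (Fin (n + 1) → ℝ) → Fin (n + 1) → Fin (n + 1) → ℝ)
    (φ : ℝ → (Fin n → ℝ) → Fin (n + 1) → ℝ) (y : Fin n → ℝ) (c a b : Fin n) : ℝ :=
  (1 / 2) * ∑ d, indMetInv g φ 0 y c d *
    (pder (fun z => indMet g φ 0 z d b) a y + pder (fun z => indMet g φ 0 z d a) b y
      - pder (fun z => indMet g φ 0 z a b) d y)

/-- The metric `g x`, as a bilinear form on coordinate vectors. -/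
def metricForm {N : ℕ} (g : (Fin N → ℝ) → Fin N → Fin N → ℝ) (x : Fin N → ℝ) :
    LinearMap.BilinForm ℝ (Fin N → ℝ) :=
  Matrix.toBilin' (Matrix.of (g x))

theorem metricForm_apply {N : ℕ} (g : (Fin N → ℝ) → Fin N → Fin N → ℝ) (x : Fin N → ℝ)
    (A B : Fin N → ℝ) :
    metricForm g x A B = ∑ μ, ∑ ν, g x μ ν * A μ * B ν := by
  simp only [metricForm, Matrix.toBilin'_apply, Matrix.of_apply]
  exact Finset.sum_congr rfl fun _ _ => Finset.sum_congr rfl fun _ _ => by ring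

theorem metricForm_comm {N : ℕ} {g : (Fin N → ℝ) → Fin N → Fin N → ℝ} {x : Fin N → ℝ}
    (hsym : ∀ μ ν, g x μ ν = g x ν μ) (A B : Fin N → ℝ) :
    metricForm g x A B = metricForm g x B A := by
  rw [metricForm_apply, metricForm_apply, Finset.sum_comm]
  refine Finset.sum_congr rfl fun μ _ => Finset.sum_congr rfl fun ν _ => ?_
  rw [hsym ν μ]; ring

/-- The covariant derivative in direction `v` of a vector field `W` along the map `Φ`. -/
def covDerivAlong {E : Type*} [NormedAddCommGroup E] [NormedSpace ℝ E] {N : ℕ}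
    (g : (Fin N → ℝ) → Fin N → Fin N → ℝ) (Φ W : E → Fin N → ℝ) (p v : E) (μ : Fin N) : ℝ :=
  fderiv ℝ (fun q => W q μ) p v
    + ∑ l, ∑ σ, christoffel g (Φ p) μ l σ * fderiv ℝ (fun q => Φ q l) p v * W p σ

/-- The differential of the map `Φ` in the fixed direction `v`, as a vector field along `Φ`. -/
def velocityAlong {E : Type*} [NormedAddCommGroup E] [NormedSpace ℝ E] {N : ℕ}
    (Φ : E → Fin N → ℝ) (v q : E) (μ : Fin N) : ℝ :=
  fderiv ℝ (fun r => Φ r μ) q v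

theorem pder_metric_symm {N : ℕ} {g : (Fin N → ℝ) → Fin N → Fin N → ℝ}
    {V : Set (Fin N → ℝ)} (hV : IsOpen V) (hgsym : ∀ x ∈ V, ∀ μ ν, g x μ ν = g x ν μ)
    {x : Fin N → ℝ} (hx : x ∈ V) (μ ν κ : Fin N) :
    pder (fun z => g z μ ν) κ x = pder (fun z => g z ν μ) κ x := by
  have h : (fun z => g z μ ν) =ᶠ[nhds x] fun z => g z ν μ := by
    filter_upwards [hV.mem_nhds hx] with z hz using hgsym z hz μ ν
  rw [pder, pder, h.fderiv_eq]

theorem christoffel_symm {N : ℕ} {g : (Fin N → ℝ) → Fin N → Fin N → ℝ}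
    {V : Set (Fin N → ℝ)} (hV : IsOpen V) (hgsym : ∀ x ∈ V, ∀ μ ν, g x μ ν = g x ν μ)
    {x : Fin N → ℝ} (hx : x ∈ V) (l μ ν : Fin N) :
    christoffel g x l μ ν = christoffel g x l ν μ := by
  unfold christoffel
  congr 1
  refine Finset.sum_congr rfl fun σ _ => ?_
  rw [pder_metric_symm hV hgsym hx μ ν σ]
  ring

theorem sum_metric_mul_christoffel {N : ℕ} {g : (Fin N → ℝ) → Fin N → Fin N → ℝ}
    {x : Fin N → ℝ} (hunit : IsUnit (Matrix.of (g x)).det) (ν κ μ : Fin N) :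
    ∑ l, g x ν l * christoffel g x l κ μ
      = (1 / 2) * (pder (fun z => g z ν μ) κ x + pder (fun z => g z ν κ) μ x
        - pder (fun z => g z κ μ) ν x) := by
  set c : Fin N → ℝ := fun σ => pder (fun z => g z σ μ) κ x + pder (fun z => g z σ κ) μ x
    - pder (fun z => g z κ μ) σ x with hc
  have h : (Matrix.of (g x)).mulVec ((Matrix.of (g x))⁻¹.mulVec c) = c := by
    rw [Matrix.mulVec_mulVec, Matrix.mul_nonsing_inv _ hunit, Matrix.one_mulVec]
  have h2 := congrFun h ν
  simp only [Matrix.mulVec, dotProduct, Matrix.of_apply] at h2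
  change _ = (1 / 2) * c ν
  rw [← h2, Finset.mul_sum]
  refine Finset.sum_congr rfl fun l _ => ?_
  simp only [christoffel, ginv, hc]
  ring

/-- The Levi-Civita connection is compatible with the metric. -/
theorem pder_metric_eq {N : ℕ} {g : (Fin N → ℝ) → Fin N → Fin N → ℝ}
    {V : Set (Fin N → ℝ)} (hV : IsOpen V) (hgsym : ∀ x ∈ V, ∀ μ ν, g x μ ν = g x ν μ)
    {x : Fin N → ℝ} (hx : x ∈ V) (hunit : IsUnit (Matrix.of (g x)).det) (κ μ ν : Fin N) :
    pder (fun z => g z μ ν) κ x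
      = ∑ l, g x l ν * christoffel g x l κ μ + ∑ l, g x μ l * christoffel g x l κ ν := by
  have h : ∑ l, g x l ν * christoffel g x l κ μ = ∑ l, g x ν l * christoffel g x l κ μ :=
    Finset.sum_congr rfl fun l _ => by rw [hgsym x hx l ν]
  rw [h, sum_metric_mul_christoffel hunit, sum_metric_mul_christoffel hunit,
    pder_metric_symm hV hgsym hx ν μ κ, pder_metric_symm hV hgsym hx ν κ μ,
    pder_metric_symm hV hgsym hx μ κ ν]
  ring

theorem fderiv_eq_sum_pder {N : ℕ} (F : (Fin N → ℝ) → ℝ) (x v : Fin N → ℝ) :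
    fderiv ℝ F x v = ∑ κ, pder F κ x * v κ := by
  conv_lhs => rw [pi_eq_sum_univ' v, map_sum]
  refine Finset.sum_congr rfl fun κ _ => ?_
  rw [map_smul, smul_eq_mul, mul_comm, pder]

/-- The product rule for the metric pairing of two vector fields along a map. -/
theorem fderiv_metricForm_along {E : Type*} [NormedAddCommGroup E] [NormedSpace ℝ E] {N : ℕ}
    {g : (Fin N → ℝ) → Fin N → Fin N → ℝ}
    {V : Set (Fin N → ℝ)} (hV : IsOpen V) (hgsym : ∀ x ∈ V, ∀ μ ν, g x μ ν = g x ν μ)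
    {Φ A B : E → Fin N → ℝ} {p : E} (hx : Φ p ∈ V)
    (hunit : IsUnit (Matrix.of (g (Φ p))).det)
    (hg : ∀ μ ν, DifferentiableAt ℝ (fun x => g x μ ν) (Φ p))
    (hΦ : ∀ μ, DifferentiableAt ℝ (fun q => Φ q μ) p)
    (hA : ∀ μ, DifferentiableAt ℝ (fun q => A q μ) p)
    (hB : ∀ μ, DifferentiableAt ℝ (fun q => B q μ) p) (v : E) :
    fderiv ℝ (fun q => metricForm g (Φ q) (A q) (B q)) p v
      = metricForm g (Φ p) (covDerivAlong g Φ A p v) (B p)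
        + metricForm g (Φ p) (A p) (covDerivAlong g Φ B p v) := by
  have hΦ' : DifferentiableAt ℝ Φ p := differentiableAt_pi.2 hΦ
  have hgΦ : ∀ μ ν, HasFDerivAt (fun q => g (Φ q) μ ν)
      ((fderiv ℝ (fun x => g x μ ν) (Φ p)).comp (fderiv ℝ Φ p)) p := fun μ ν =>
    (hg μ ν).hasFDerivAt.comp p hΦ'.hasFDerivAt
  have hΦv : ∀ κ, fderiv ℝ Φ p v κ = fderiv ℝ (fun q => Φ q κ) p v := fun κ => by
    rw [fderiv_apply hΦ' κ]; rfl
  have key := HasFDerivAt.fun_sum (u := Finset.univ) fun μ _ =>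
    HasFDerivAt.fun_sum (u := Finset.univ) fun ν _ =>
      ((hgΦ μ ν).fun_mul (hA μ).hasFDerivAt).fun_mul (hB ν).hasFDerivAt
  simp only [metricForm_apply]
  rw [key.fderiv]
  simp only [sum_apply, add_apply, smul_apply, smul_eq_mul, ContinuousLinearMap.comp_apply,
    fderiv_eq_sum_pder (fun x => g x _ _), hΦv]
  simp only [pder_metric_eq hV hgsym hx hunit, covDerivAlong]
  set w : Fin N → ℝ := fun κ => fderiv ℝ (fun q => Φ q κ) p v
  set dA : Fin N → ℝ := fun μ => fderiv ℝ (fun q => A q μ) p v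
  set dB : Fin N → ℝ := fun μ => fderiv ℝ (fun q => B q μ) p v
  set Γ := christoffel g (Φ p)
  have swap : ∀ F : Fin N → Fin N → Fin N → ℝ,
      ∑ a, ∑ b, ∑ c, F a b c = ∑ c, ∑ b, ∑ a, F a b c := fun F => by
    rw [Finset.sum_comm]
    simp_rw [Finset.sum_comm (f := fun a c => F a _ c)]
    rw [Finset.sum_comm]
  have hleft : ∑ μ, ∑ ν, B p ν * (A p μ * ∑ κ, (∑ l, g (Φ p) l ν * Γ l κ μ) * w κ)
      = ∑ μ, ∑ ν, g (Φ p) μ ν * (∑ l, ∑ σ, Γ μ l σ * w l * A p σ) * B p ν := by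
    rw [Finset.sum_comm, Finset.sum_comm (f := fun μ ν => g (Φ p) μ ν * _ * _)]
    refine Finset.sum_congr rfl fun ν _ => ?_
    simp only [Finset.mul_sum, Finset.sum_mul]
    rw [swap]
    refine Finset.sum_congr rfl fun _ _ => Finset.sum_congr rfl fun _ _ =>
      Finset.sum_congr rfl fun _ _ => by ring
  have hright : ∑ μ, ∑ ν, B p ν * (A p μ * ∑ κ, (∑ l, g (Φ p) μ l * Γ l κ ν) * w κ)
      = ∑ μ, ∑ ν, g (Φ p) μ ν * A p μ * (∑ l, ∑ σ, Γ ν l σ * w l * B p σ) := by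
    refine Finset.sum_congr rfl fun μ _ => ?_
    simp only [Finset.mul_sum, Finset.sum_mul]
    rw [swap]
    refine Finset.sum_congr rfl fun _ _ => Finset.sum_congr rfl fun _ _ =>
      Finset.sum_congr rfl fun _ _ => by ring
  have hsplit : ∀ μ ν, g (Φ p) μ ν * A p μ * dB ν + B p ν * (g (Φ p) μ ν * dA μ
      + A p μ * ∑ κ, (∑ l, g (Φ p) l ν * Γ l κ μ + ∑ l, g (Φ p) μ l * Γ l κ ν) * w κ)
      = g (Φ p) μ ν * dA μ * B p ν + g (Φ p) μ ν * A p μ * dB ν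
        + B p ν * (A p μ * ∑ κ, (∑ l, g (Φ p) l ν * Γ l κ μ) * w κ)
        + B p ν * (A p μ * ∑ κ, (∑ l, g (Φ p) μ l * Γ l κ ν) * w κ) := fun μ ν => by
    simp only [add_mul, Finset.sum_add_distrib]
    ring
  refine (Finset.sum_congr rfl fun μ _ => Finset.sum_congr rfl fun ν _ => hsplit μ ν).trans ?_
  simp only [mul_add, add_mul, Finset.sum_add_distrib]
  rw [hleft, hright]
  ring

theorem covDerivAlong_velocityAlong_comm {E : Type*} [NormedAddCommGroup E] [NormedSpace ℝ E]
    {N : ℕ} {g : (Fin N → ℝ) → Fin N → Fin N → ℝ}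
    {V : Set (Fin N → ℝ)} (hV : IsOpen V) (hgsym : ∀ x ∈ V, ∀ μ ν, g x μ ν = g x ν μ)
    {Φ : E → Fin N → ℝ} {p : E} (hx : Φ p ∈ V)
    (hΦ : ∀ μ, ContDiffAt ℝ 2 (fun q => Φ q μ) p) (v w : E) :
    covDerivAlong g Φ (velocityAlong Φ v) p w = covDerivAlong g Φ (velocityAlong Φ w) p v := by
  ext μ
  have hd : DifferentiableAt ℝ (fderiv ℝ fun q => Φ q μ) p :=
    ((hΦ μ).fderiv_right (m := 1) (by norm_num)).differentiableAt (by norm_num)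
  have hs : IsSymmSndFDerivAt ℝ (fun q => Φ q μ) p :=
    (hΦ μ).isSymmSndFDerivAt (by simp)
  unfold covDerivAlong velocityAlong
  congr 1
  · rw [fderiv_clm_apply hd (differentiableAt_const v),
      fderiv_clm_apply hd (differentiableAt_const w)]
    simpa using hs.eq w v
  · rw [Finset.sum_comm]
    refine Finset.sum_congr rfl fun l _ => Finset.sum_congr rfl fun σ _ => ?_
    rw [christoffel_symm hV hgsym hx μ σ l]
    ring

theorem eq_zero_of_metricForm_eq_zero {n : ℕ}
    {g : (Fin (n + 1) → ℝ) → Fin (n + 1) → Fin (n + 1) → ℝ} {x : Fin (n + 1) → ℝ}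
    (hunit : IsUnit (Matrix.of (g x)).det) {ν : Fin (n + 1) → ℝ}
    {τ : Fin n → Fin (n + 1) → ℝ} (hνν : metricForm g x ν ν ≠ 0)
    (hντ : ∀ a, metricForm g x ν (τ a) = 0) (hτ : LinearIndependent ℝ τ)
    {z : Fin (n + 1) → ℝ} (hzν : metricForm g x z ν = 0)
    (hzτ : ∀ a, metricForm g x z (τ a) = 0) : z = 0 := by
  have hnd : (metricForm g x).Nondegenerate :=
    LinearMap.BilinForm.nondegenerate_toBilin'_iff_det_ne_zero.2 hunit.ne_zero
  have hν : ν ∉ Submodule.span ℝ (Set.range τ) := fun hmem => by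
    have hle : Submodule.span ℝ (Set.range τ) ≤ LinearMap.ker (metricForm g x ν) := by
      rw [Submodule.span_le]
      rintro _ ⟨a, rfl⟩
      exact hντ a
    exact hνν (hle hmem)
  have hli : LinearIndependent ℝ (Fin.cons ν τ : Fin (n + 1) → Fin (n + 1) → ℝ) :=
    linearIndependent_finCons.2 ⟨hτ, hν⟩
  have htop := hli.span_eq_top_of_card_eq_finrank' (by simp)
  have hle : Submodule.span ℝ (Set.range (Fin.cons ν τ : Fin (n + 1) → Fin (n + 1) → ℝ))
      ≤ LinearMap.ker (metricForm g x z) := by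
    rw [Submodule.span_le]
    rintro _ ⟨i, rfl⟩
    refine Fin.cases ?_ (fun a => ?_) i
    · exact hzν
    · exact hzτ a
  rw [htop, top_le_iff] at hle
  refine hnd.1 z fun w => ?_
  have : w ∈ LinearMap.ker (metricForm g x z) := hle ▸ Submodule.mem_top
  exact this

theorem pder_slice {n : ℕ} {F : ℝ × (Fin n → ℝ) → ℝ} {t : ℝ} {y : Fin n → ℝ}
    (hF : DifferentiableAt ℝ F (t, y)) (a : Fin n) :
    pder (fun z => F (t, z)) a y = fderiv ℝ F (t, y) (0, Pi.single a 1) := by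
  have h : HasFDerivAt (fun z => F (t, z)) _ y :=
    hF.hasFDerivAt.comp y (hasFDerivAt_prodMk_right t y)
  rw [pder, h.fderiv]
  rfl

theorem deriv_slice {n : ℕ} {F : ℝ × (Fin n → ℝ) → ℝ} {t : ℝ} {y : Fin n → ℝ}
    (hF : DifferentiableAt ℝ F (t, y)) :
    deriv (fun s => F (s, y)) t = fderiv ℝ F (t, y) (1, 0) := by
  have h : HasFDerivAt (fun s => F (s, y)) _ t :=
    hF.hasFDerivAt.comp t (hasFDerivAt_prodMk_left t y)
  rw [← fderiv_apply_one_eq_deriv, h.fderiv]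
  rfl

/-- Lemma 5.4 (2) of the paper, in local coordinates: the covariant
`t`-derivative of the family of unit normals at `t = 0` equals `Tφ₀` applied to
`−ϵ grad^Σ f + (i_X K)^{♯_h}`. -/
theorem first_variation_unit_normal
    (n : ℕ) (hn : 1 ≤ n)
    (U : Set (Fin n → ℝ)) (hU : IsOpen U)
    (V : Set (Fin (n + 1) → ℝ)) (hV : IsOpen V)
    (g : (Fin (n + 1) → ℝ) → Fin (n + 1) → Fin (n + 1) → ℝ)
    (hg : ∀ μ ν, ContDiffOn ℝ (⊤ : ℕ∞) (fun x => g x μ ν) V)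
    (hgsym : ∀ x ∈ V, ∀ μ ν, g x μ ν = g x ν μ)
    (hgunit : ∀ x ∈ V, IsUnit (Matrix.of (g x)).det)
    (δ : ℝ) (hδ : 0 < δ)
    (φ : ℝ → (Fin n → ℝ) → Fin (n + 1) → ℝ)
    (hφ : ∀ μ, ContDiffOn ℝ (⊤ : ℕ∞) (fun q : ℝ × (Fin n → ℝ) => φ q.1 q.2 μ)
      (Set.Ioo (-δ) δ ×ˢ U))
    (hφV : ∀ t ∈ Set.Ioo (-δ) δ, ∀ y ∈ U, φ t y ∈ V)
    (himm : ∀ t ∈ Set.Ioo (-δ) δ, ∀ y ∈ U, ∀ v : Fin n → ℝ,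
      (∀ μ, (∑ a, v a * Dphi φ t y a μ) = 0) → v = 0)
    (nrm : ℝ → (Fin n → ℝ) → Fin (n + 1) → ℝ)
    (hnrm : ∀ μ, ContDiffOn ℝ (⊤ : ℕ∞) (fun q : ℝ × (Fin n → ℝ) => nrm q.1 q.2 μ)
      (Set.Ioo (-δ) δ ×ˢ U))
    (ϵ : ℝ) (hϵ : ϵ = 1 ∨ ϵ = -1)
    (horth : ∀ t ∈ Set.Ioo (-δ) δ, ∀ y ∈ U, ∀ a : Fin n,
      (∑ μ, ∑ ν, g (φ t y) μ ν * nrm t y μ * Dphi φ t y a ν) = 0)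
    (hunit : ∀ t ∈ Set.Ioo (-δ) δ, ∀ y ∈ U,
      (∑ μ, ∑ ν, g (φ t y) μ ν * nrm t y μ * nrm t y ν) = ϵ)
    (f : (Fin n → ℝ) → ℝ) (hf : ContDiffOn ℝ (⊤ : ℕ∞) f U)
    (X : (Fin n → ℝ) → Fin n → ℝ) (hX : ∀ a, ContDiffOn ℝ (⊤ : ℕ∞) (fun y => X y a) U)
    (hdec : ∀ y ∈ U, ∀ μ, deriv (fun t => φ t y μ) 0
      = f y * nrm 0 y μ + ∑ a, X y a * Dphi φ 0 y a μ)
    (hh0 : ∀ y ∈ U, IsUnit (Matrix.of (fun a b => indMet g φ 0 y a b)).det) :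
    ∀ y ∈ U, ∀ μ : Fin (n + 1),
      deriv (fun t => nrm t y μ) 0
          + ∑ l, ∑ σ, christoffel g (φ 0 y) μ l σ
              * deriv (fun t => φ t y l) 0 * nrm 0 y σ
        = ∑ a, ∑ b, Dphi φ 0 y a μ * indMetInv g φ 0 y a b
            * (-ϵ * pder f b y + ∑ c, extK g φ nrm 0 y b c * X y c) := by
  intro y hy
  set S : Set (ℝ × (Fin n → ℝ)) := Set.Ioo (-δ) δ ×ˢ U
  have hS : IsOpen S := isOpen_Ioo.prod hU
  have h0 : (0 : ℝ) ∈ Set.Ioo (-δ) δ := ⟨by linarith, hδ⟩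
  have hp : ((0 : ℝ), y) ∈ S := ⟨h0, hy⟩
  set Φ : ℝ × (Fin n → ℝ) → Fin (n + 1) → ℝ := fun q => φ q.1 q.2
  set ν : ℝ × (Fin n → ℝ) → Fin (n + 1) → ℝ := fun q => nrm q.1 q.2
  set p : ℝ × (Fin n → ℝ) := (0, y)
  set e : Fin n → ℝ × (Fin n → ℝ) := fun a => (0, Pi.single a 1)
  set e₀ : ℝ × (Fin n → ℝ) := (1, 0)
  have hΦC : ∀ q ∈ S, ∀ μ, ContDiffAt ℝ (⊤ : ℕ∞) (fun q => Φ q μ) q := fun q hq μ =>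
    (hφ μ).contDiffAt (hS.mem_nhds hq)
  have hΦd : ∀ q ∈ S, ∀ μ, DifferentiableAt ℝ (fun q => Φ q μ) q := fun q hq μ =>
    (hΦC q hq μ).differentiableAt (by simp)
  have hνd : ∀ q ∈ S, ∀ μ, DifferentiableAt ℝ (fun q => ν q μ) q := fun q hq μ =>
    ((hnrm μ).contDiffAt (hS.mem_nhds hq)).differentiableAt (by simp)
  have hΦC2 : ∀ μ, ContDiffAt ℝ 2 (fun q => Φ q μ) p := fun μ =>
    (hΦC p hp μ).of_le (WithTop.coe_le_coe.2 (le_top : (2 : ℕ∞) ≤ ⊤))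
  have hTd : ∀ v μ, DifferentiableAt ℝ (fun q => velocityAlong Φ v q μ) p := fun v μ =>
    (((hΦC2 μ).fderiv_right (m := 1) (by norm_num)).differentiableAt (by norm_num)).clm_apply
      (differentiableAt_const v)
  have hx : Φ p ∈ V := hφV 0 h0 y hy
  have hgd : ∀ μ ν, DifferentiableAt ℝ (fun x => g x μ ν) (Φ p) := fun μ ν =>
    ((hg μ ν).contDiffAt (hV.mem_nhds hx)).differentiableAt (by simp)
  have hgu := hgunit _ hx
  have hcomm : ∀ A B, metricForm g (Φ p) A B = metricForm g (Φ p) B A :=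
    metricForm_comm (hgsym _ hx)
  have hD : ∀ q ∈ S, ∀ a, Dphi φ q.1 q.2 a = velocityAlong Φ (e a) q := fun q hq a => by
    ext μ
    exact pder_slice (F := fun q => Φ q μ) (hΦd q hq μ) a
  have hT₀ : ∀ z ∈ U, (fun μ => deriv (fun t => φ t z μ) 0) = velocityAlong Φ e₀ (0, z) :=
    fun z hz => by
      ext μ
      exact deriv_slice (F := fun q => Φ q μ) (hΦd (0, z) ⟨h0, hz⟩ μ)
  have hdec' : ∀ z ∈ U, velocityAlong Φ e₀ (0, z)
      = f z • ν (0, z) + ∑ c, X z c • velocityAlong Φ (e c) (0, z) := fun z hz => by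
    rw [← hT₀ z hz]
    ext μ
    simp only [Pi.add_apply, Pi.smul_apply, Finset.sum_apply, smul_eq_mul,
      ← hD (0, z) ⟨h0, hz⟩]
    exact hdec z hz μ
  have horth' : ∀ q ∈ S, ∀ a, metricForm g (Φ q) (ν q) (velocityAlong Φ (e a) q) = 0 :=
    fun q hq a => by
      rw [metricForm_apply, ← hD q hq]
      exact horth q.1 hq.1 q.2 hq.2 a
  have hunit' : ∀ q ∈ S, metricForm g (Φ q) (ν q) (ν q) = ϵ := fun q hq => by
    rw [metricForm_apply]
    exact hunit q.1 hq.1 q.2 hq.2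
  have hnormal : ∀ v, metricForm g (Φ p) (covDerivAlong g Φ ν p v) (ν p) = 0 := fun v => by
    have h := fderiv_metricForm_along hV hgsym hx hgu hgd (hΦd p hp) (hνd p hp) (hνd p hp) v
    have hc : (fun q => metricForm g (Φ q) (ν q) (ν q)) =ᶠ[nhds p] fun _ => ϵ := by
      filter_upwards [hS.mem_nhds hp] with q hq using hunit' q hq
    rw [hc.fderiv_eq, hcomm (ν p)] at h
    simp only [fderiv_fun_const, Pi.zero_apply, zero_apply] at h
    linarith
  have htangent : ∀ v a, metricForm g (Φ p) (covDerivAlong g Φ ν p v) (velocityAlong Φ (e a) p)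
      = -metricForm g (Φ p) (ν p) (covDerivAlong g Φ (velocityAlong Φ (e a)) p v) :=
    fun v a => by
      have h := fderiv_metricForm_along hV hgsym hx hgu hgd (hΦd p hp) (hνd p hp)
        (hTd (e a)) v
      have hc : (fun q => metricForm g (Φ q) (ν q) (velocityAlong Φ (e a) q))
          =ᶠ[nhds p] fun _ => 0 := by
        filter_upwards [hS.mem_nhds hp] with q hq using horth' q hq a
      rw [hc.fderiv_eq] at h
      simp only [fderiv_fun_const, Pi.zero_apply, zero_apply] at h
      linarith
  have hsymm : ∀ v w, covDerivAlong g Φ (velocityAlong Φ v) p w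
      = covDerivAlong g Φ (velocityAlong Φ w) p v :=
    covDerivAlong_velocityAlong_comm hV hgsym hx hΦC2
  have hK : ∀ a b, extK g φ nrm 0 y a b
      = metricForm g (Φ p) (velocityAlong Φ (e a) p) (covDerivAlong g Φ ν p (e b)) :=
    fun a b => by
      rw [metricForm_apply, ← hD p hp]
      refine Finset.sum_congr rfl fun μ _ => Finset.sum_congr rfl fun κ _ => ?_
      congr 1
      simp only [covDerivAlong]
      congr 1
      · exact pder_slice (F := fun q => ν q κ) (hνd p hp κ) b
      · refine Finset.sum_congr rfl fun l _ => Finset.sum_congr rfl fun σ _ => ?_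
        congr 2
        exact congrFun (hD p hp b) l
  have hKsymm : ∀ a b, extK g φ nrm 0 y a b = extK g φ nrm 0 y b a := fun a b => by
    rw [hK, hK, hcomm, hcomm (velocityAlong Φ (e b) p), htangent, htangent, hsymm]
  have hf' : ∀ a, fderiv ℝ (fun q => metricForm g (Φ q) (ν q) (velocityAlong Φ e₀ q)) p (e a)
      = ϵ * pder f a y := fun a => by
    have hdiff : DifferentiableAt ℝ
        (fun q => metricForm g (Φ q) (ν q) (velocityAlong Φ e₀ q)) p := by
      simp only [metricForm_apply]
      refine DifferentiableAt.fun_sum fun μ _ => DifferentiableAt.fun_sum fun κ _ => ?_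
      exact (((hgd μ κ).comp p (differentiableAt_pi.2 (hΦd p hp))).mul (hνd p hp μ)).mul
        (hTd e₀ κ)
    have hc : (fun z => metricForm g (Φ (0, z)) (ν (0, z)) (velocityAlong Φ e₀ (0, z)))
        =ᶠ[nhds y] fun z => ϵ * f z := by
      filter_upwards [hU.mem_nhds hy] with z hz
      have hz' : ((0 : ℝ), z) ∈ S := ⟨h0, hz⟩
      rw [hdec' z hz]
      simp only [map_add, map_sum, map_smul, smul_eq_mul, horth' _ hz', hunit' _ hz']
      simp [mul_comm]
    rw [← pder_slice hdiff a, pder, hc.fderiv_eq,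
      fderiv_const_mul ((hf.contDiffAt (hU.mem_nhds hy)).differentiableAt (by simp))]
    rfl
  have hvar : ∀ a, metricForm g (Φ p) (covDerivAlong g Φ ν p e₀) (velocityAlong Φ (e a) p)
      = -ϵ * pder f a y + ∑ c, extK g φ nrm 0 y a c * X y c := fun a => by
    have h := fderiv_metricForm_along hV hgsym hx hgu hgd (hΦd p hp) (hνd p hp) (hTd e₀) (e a)
    rw [hf', hdec' y hy] at h
    simp only [map_add, map_sum, map_smul, smul_eq_mul] at h
    rw [hnormal] at h
    have hsum : ∑ c, X y c * metricForm g (Φ p) (covDerivAlong g Φ ν p (e a))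
        (velocityAlong Φ (e c) p) = ∑ c, extK g φ nrm 0 y a c * X y c :=
      Finset.sum_congr rfl fun c _ => by rw [hKsymm a c, hK, hcomm, mul_comm]
    rw [hsum] at h
    rw [htangent, hsymm]
    linarith
  have hind : ∀ a b, indMet g φ 0 y a b
      = metricForm g (Φ p) (velocityAlong Φ (e a) p) (velocityAlong Φ (e b) p) := fun a b => by
    rw [metricForm_apply, ← hD p hp, ← hD p hp]
    rfl
  have hli : LinearIndependent ℝ fun a => velocityAlong Φ (e a) p := by
    rw [Fintype.linearIndependent_iff]
    intro v hv
    refine congrFun (himm 0 h0 y hy v fun μ => ?_)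
    have h := congrFun hv μ
    simp only [Finset.sum_apply, Pi.smul_apply, smul_eq_mul, ← hD p hp] at h
    exact h
  set Q : Fin n → ℝ := fun b => -ϵ * pder f b y + ∑ c, extK g φ nrm 0 y b c * X y c
  set R : Fin (n + 1) → ℝ :=
    ∑ a, ∑ b, (indMetInv g φ 0 y a b * Q b) • velocityAlong Φ (e a) p with hR
  have hRν : metricForm g (Φ p) R (ν p) = 0 := by
    rw [hcomm]
    simp [hR, horth' p hp]
  have hRτ : ∀ c, metricForm g (Φ p) R (velocityAlong Φ (e c) p) = Q c := fun c => by
    set H := Matrix.of (fun a b => indMet g φ 0 y a b)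
    have h : H.mulVec (H⁻¹.mulVec Q) = Q := by
      rw [Matrix.mulVec_mulVec, Matrix.mul_nonsing_inv _ (hh0 y hy), Matrix.one_mulVec]
    have h2 := congrFun h c
    simp only [Matrix.mulVec, dotProduct] at h2
    rw [hcomm, ← h2, hR]
    simp only [map_sum, map_smul, smul_eq_mul, ← hind]
    refine Finset.sum_congr rfl fun a _ => ?_
    rw [← Finset.sum_mul, mul_comm]
    rfl
  have hfinal : covDerivAlong g Φ ν p e₀ - R = 0 := by
    refine eq_zero_of_metricForm_eq_zero hgu (ν := ν p)
      (τ := fun a => velocityAlong Φ (e a) p) ?_ (horth' p hp) hli ?_ fun a => ?_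
    · rw [hunit' p hp]
      rcases hϵ with rfl | rfl <;> norm_num
    · rw [map_sub, LinearMap.sub_apply, hnormal, hRν, sub_zero]
    · rw [map_sub, LinearMap.sub_apply, hvar, hRτ, sub_self]
  intro μ
  have h := congrFun (sub_eq_zero.1 hfinal) μ
  have hL : covDerivAlong g Φ ν p e₀ μ = deriv (fun t => nrm t y μ) 0
      + ∑ l, ∑ σ, christoffel g (φ 0 y) μ l σ
          * deriv (fun t => φ t y l) 0 * nrm 0 y σ := by
    simp only [covDerivAlong]
    congr 1
    · exact (deriv_slice (F := fun q => ν q μ) (hνd p hp μ)).symm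
    · refine Finset.sum_congr rfl fun l _ => Finset.sum_congr rfl fun σ _ => ?_
      congr 2
      exact (congrFun (hT₀ y hy) l).symm
  rw [← hL, h, hR]
  simp only [Finset.sum_apply, Pi.smul_apply, smul_eq_mul, ← hD p hp]
  refine Finset.sum_congr rfl fun a _ => Finset.sum_congr rfl fun b _ => ?_
  change _ = Dphi φ 0 y a μ * indMetInv g φ 0 y a b * Q b
  ring
end
end

section
/- In the coordinate hypersurface-variation setup, the first variation of the induced volume factor is ∂_t √|det h_t| |_{t=0} = √|det h| · ( f k + div^Σ X ) at every point of U, where h := h₀ and div^Σ X := Σ_a ∂_a X^a + (1/2) Σ_{a,b,c} h^{ab} X^c ∂_c h_{ab}. -/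
noncomputable section

/-- Jacobi's formula for the derivative of a determinant. -/
lemma hasDerivAt_matrix_det {n : ℕ} {M : ℝ → Matrix (Fin n) (Fin n) ℝ}
    {M' : Matrix (Fin n) (Fin n) ℝ} {t : ℝ}
    (h : ∀ a b, HasDerivAt (fun s => M s a b) (M' a b) t) :
    HasDerivAt (fun s => (M s).det) (∑ a, ∑ b, (M t).adjugate a b * M' b a) t := by
  have h1 : HasDerivAt (fun s => (M s).det)
      (∑ σ : Equiv.Perm (Fin n), (Equiv.Perm.sign σ : ℝ) *
        ∑ i, (∏ j ∈ Finset.univ.erase i, M t (σ j) j) • M' (σ i) i) t := by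
    simp only [Matrix.det_apply']
    exact HasDerivAt.fun_sum fun σ _ =>
      (HasDerivAt.fun_finsetProd fun i _ => h (σ i) i).const_mul _
  convert h1 using 1
  have h2 : ∀ a, ∑ b, (M t).adjugate a b * M' b a
      = ((M t).updateCol a (fun b => M' b a)).det := by
    intro a
    rw [← Matrix.cramer_apply, Matrix.cramer_eq_adjugate_mulVec]
    rfl
  simp only [h2, Matrix.det_apply', Finset.mul_sum]
  rw [Finset.sum_comm]
  refine Finset.sum_congr rfl fun σ _ => Finset.sum_congr rfl fun i _ => ?_
  rw [← Finset.mul_prod_erase _ _ (Finset.mem_univ i), smul_eq_mul, Matrix.updateCol_self,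
    mul_comm _ (M' (σ i) i)]
  congr 2
  refine Finset.prod_congr rfl fun j hj => ?_
  rw [Matrix.updateCol_ne (Finset.ne_of_mem_erase hj)]

/-- The derivative of `√|det M|` along a curve of matrices, where `M` is invertible. -/
lemma hasDerivAt_sqrt_abs_det {n : ℕ} {M : ℝ → Matrix (Fin n) (Fin n) ℝ}
    {M' : Matrix (Fin n) (Fin n) ℝ} {t : ℝ} (hM : IsUnit (M t).det)
    (h : ∀ a b, HasDerivAt (fun s => M s a b) (M' a b) t) :
    HasDerivAt (fun s => √|(M s).det|)
      (√|(M t).det| * ((1 / 2) * ∑ a, ∑ b, (M t)⁻¹ a b * M' b a)) t := by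
  have hne : (M t).det ≠ 0 := hM.ne_zero
  have hadj : ∑ a, ∑ b, (M t).adjugate a b * M' b a
      = (M t).det * ∑ a, ∑ b, (M t)⁻¹ a b * M' b a := by
    simp only [Finset.mul_sum, Matrix.inv_def, Ring.inverse_eq_inv', Matrix.smul_apply,
      smul_eq_mul]
    refine Finset.sum_congr rfl fun a _ => Finset.sum_congr rfl fun b _ => ?_
    field_simp
  have h1 := hasDerivAt_matrix_det h
  rw [hadj] at h1
  have h2 : HasDerivAt (fun s => |(M s).det|) (SignType.sign (M t).det
      * ((M t).det * ∑ a, ∑ b, (M t)⁻¹ a b * M' b a)) t :=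
    HasDerivAt.comp (h₂ := fun x : ℝ => |x|) t (hasDerivAt_abs hne) h1
  refine (h2.sqrt (abs_ne_zero.mpr hne)).congr_deriv ?_
  have hs : (SignType.sign (M t).det : ℝ) * (M t).det = |(M t).det| := sign_mul_self _
  have hsq : √|(M t).det| * √|(M t).det| = |(M t).det| := Real.mul_self_sqrt (abs_nonneg _)
  have hpos : √|(M t).det| ≠ 0 := (Real.sqrt_pos.mpr (abs_pos.mpr hne)).ne'
  rw [← mul_assoc, hs, div_eq_iff (mul_ne_zero two_ne_zero hpos)]
  linear_combination -(∑ a, ∑ b, (M t)⁻¹ a b * M' b a) * hsq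

section MixedPartials

variable {E : Type*} [NormedAddCommGroup E] [NormedSpace ℝ E]

/-- Directional derivatives of a `C²` function commute. -/
lemma fderiv_fderiv_apply_comm {F : E → ℝ} {x : E} (hF : ContDiffAt ℝ 2 F x) (v w : E) :
    fderiv ℝ (fun z => fderiv ℝ F z v) x w = fderiv ℝ (fun z => fderiv ℝ F z w) x v := by
  have hd : DifferentiableAt ℝ (fderiv ℝ F) x :=
    (hF.fderiv_right (m := 1) (by norm_num)).differentiableAt (by norm_num)
  rw [fderiv_clm_apply hd (differentiableAt_const v),
    fderiv_clm_apply hd (differentiableAt_const w)]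
  simpa using hF.isSymmSndFDerivAt (by simp) w v

lemma differentiableAt_fderiv_apply {F : E → ℝ} {x : E} (hF : ContDiffAt ℝ 2 F x) (v : E) :
    DifferentiableAt ℝ (fun z => fderiv ℝ F z v) x :=
  ((hF.fderiv_right (m := 1) (by norm_num)).differentiableAt (by norm_num)).clm_apply
    (differentiableAt_const v)

lemma contDiffAt_slice_right {F : ℝ × E → ℝ} {t : ℝ} {y : E} {k : WithTop ℕ∞}
    (hF : ContDiffAt ℝ k F (t, y)) : ContDiffAt ℝ k (fun z => F (t, z)) y :=
  ContDiffAt.comp y (g := F) (f := fun z => (t, z)) hF (contDiffAt_const.prodMk contDiffAt_id)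

lemma fderiv_slice_right {F : ℝ × E → ℝ} {t : ℝ} {y : E}
    (hF : DifferentiableAt ℝ F (t, y)) (v : E) :
    fderiv ℝ (fun z => F (t, z)) y v = fderiv ℝ F (t, y) (0, v) := by
  have h := hF.hasFDerivAt.comp y ((hasFDerivAt_const t y).prodMk (hasFDerivAt_id y))
  rw [HasFDerivAt.fderiv (f := fun z => F (t, z)) h]
  simp

lemma hasDerivAt_slice_left {F : ℝ × E → ℝ} {t : ℝ} {y : E}
    (hF : DifferentiableAt ℝ F (t, y)) :
    HasDerivAt (fun s => F (s, y)) (fderiv ℝ F (t, y) (1, 0)) t :=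
  hF.hasFDerivAt.comp_hasDerivAt t ((hasDerivAt_id t).prodMk (hasDerivAt_const t y))

/-- For a jointly `C²` function, differentiation in the parameter and in the spatial
variable commute. -/
lemma hasDerivAt_fderiv_slice {F : ℝ × E → ℝ} {t : ℝ} {y : E}
    (hF : ContDiffAt ℝ 2 F (t, y)) (v : E) :
    HasDerivAt (fun s => fderiv ℝ (fun z => F (s, z)) y v)
      (fderiv ℝ (fun z => deriv (fun s => F (s, z)) t) y v) t := by
  have hev : ∀ᶠ q in nhds (t, y), DifferentiableAt ℝ F q :=
    (hF.eventually (by simp)).mono fun q hq => hq.differentiableAt (by norm_num)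
  have hs : ∀ᶠ s in nhds t, DifferentiableAt ℝ F (s, y) :=
    (continuous_id.prodMk continuous_const).continuousAt.eventually hev
  have hz : ∀ᶠ z in nhds y, DifferentiableAt ℝ F (t, z) :=
    (continuous_const.prodMk continuous_id).continuousAt.eventually hev
  have e1 : (fun s => fderiv ℝ (fun z => F (s, z)) y v)
      =ᶠ[nhds t] fun s => fderiv ℝ F (s, y) (0, v) :=
    hs.mono fun s h => fderiv_slice_right h v
  have e2 : (fun z => deriv (fun s => F (s, z)) t)
      =ᶠ[nhds y] fun z => fderiv ℝ F (t, z) (1, 0) :=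
    hz.mono fun z h => (hasDerivAt_slice_left h).deriv
  rw [e2.fderiv_eq, fderiv_slice_right (F := fun q => fderiv ℝ F q (1, 0))
    (differentiableAt_fderiv_apply hF _), fderiv_fderiv_apply_comm hF]
  exact (hasDerivAt_slice_left (F := fun q => fderiv ℝ F q (0, v))
    (differentiableAt_fderiv_apply hF _)).congr_of_eventuallyEq e1

end MixedPartials

section TensorContractions

variable {N : ℕ}

/-- The contraction `Σ_{μν} G_{μν} u^μ v^ν`. -/
def contract₂ (G : Fin N → Fin N → ℝ) (u v : Fin N → ℝ) : ℝ :=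
  ∑ μ, ∑ ν, G μ ν * u μ * v ν

/-- The contraction `Σ_{ρμν} D_{ρμν} w^ρ u^μ v^ν`. -/
def contract₃ (D : Fin N → Fin N → Fin N → ℝ) (w u v : Fin N → ℝ) : ℝ :=
  ∑ ρ, w ρ * contract₂ (D ρ) u v

lemma contract₂_comm {G : Fin N → Fin N → ℝ} (hG : ∀ μ ν, G μ ν = G ν μ) (u v : Fin N → ℝ) :
    contract₂ G u v = contract₂ G v u := by
  unfold contract₂
  rw [Finset.sum_comm]
  refine Finset.sum_congr rfl fun μ _ => Finset.sum_congr rfl fun ν _ => ?_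
  rw [hG]; ring

lemma contract₂_add_left (G : Fin N → Fin N → ℝ) (u u' v : Fin N → ℝ) :
    contract₂ G (u + u') v = contract₂ G u v + contract₂ G u' v := by
  simp only [contract₂, Pi.add_apply, mul_add, add_mul, Finset.sum_add_distrib]

lemma contract₂_smul_left (G : Fin N → Fin N → ℝ) (c : ℝ) (u v : Fin N → ℝ) :
    contract₂ G (c • u) v = c * contract₂ G u v := by
  simp only [contract₂, Pi.smul_apply, smul_eq_mul, Finset.mul_sum]
  refine Finset.sum_congr rfl fun μ _ => Finset.sum_congr rfl fun ν _ => ?_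
  ring

lemma contract₂_sum_left {ι : Type*} (s : Finset ι) (G : Fin N → Fin N → ℝ)
    (u : ι → Fin N → ℝ) (v : Fin N → ℝ) :
    contract₂ G (∑ c ∈ s, u c) v = ∑ c ∈ s, contract₂ G (u c) v := by
  induction s using Finset.cons_induction with
  | empty => simp [contract₂]
  | cons a s ha ih => simp only [Finset.sum_cons, contract₂_add_left, ih]

lemma contract₃_comm_right {D : Fin N → Fin N → Fin N → ℝ}
    (hD : ∀ ρ μ ν, D ρ μ ν = D ρ ν μ) (w u v : Fin N → ℝ) :
    contract₃ D w u v = contract₃ D w v u :=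
  Finset.sum_congr rfl fun ρ _ => by rw [contract₂_comm (hD ρ)]

lemma contract₃_add_left (D : Fin N → Fin N → Fin N → ℝ) (w w' u v : Fin N → ℝ) :
    contract₃ D (w + w') u v = contract₃ D w u v + contract₃ D w' u v := by
  simp only [contract₃, Pi.add_apply, add_mul, Finset.sum_add_distrib]

lemma contract₃_smul_left (D : Fin N → Fin N → Fin N → ℝ) (c : ℝ) (w u v : Fin N → ℝ) :
    contract₃ D (c • w) u v = c * contract₃ D w u v := by
  simp only [contract₃, Pi.smul_apply, smul_eq_mul, Finset.mul_sum, mul_assoc]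

lemma contract₃_sum_left {ι : Type*} (s : Finset ι) (D : Fin N → Fin N → Fin N → ℝ)
    (w : ι → Fin N → ℝ) (u v : Fin N → ℝ) :
    contract₃ D (∑ c ∈ s, w c) u v = ∑ c ∈ s, contract₃ D (w c) u v := by
  induction s using Finset.cons_induction with
  | empty => simp [contract₃]
  | cons a s ha ih => simp only [Finset.sum_cons, contract₃_add_left, ih]

lemma contract₃_eq_sum (D : Fin N → Fin N → Fin N → ℝ) (w u v : Fin N → ℝ) :
    contract₃ D w u v = ∑ ρ, ∑ μ, ∑ ν, D ρ μ ν * w ρ * u μ * v ν := by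
  simp only [contract₃, contract₂, Finset.mul_sum]
  refine Finset.sum_congr rfl fun ρ _ => Finset.sum_congr rfl fun μ _ =>
    Finset.sum_congr rfl fun ν _ => ?_
  ring

/-- Product and chain rule for `Σ_{μν} g_{μν}(x) u^μ v^ν`. -/
lemma differentiableAt_and_fderiv_contract₂ {E : Type*} [NormedAddCommGroup E] [NormedSpace ℝ E]
    {g : (Fin N → ℝ) → Fin N → Fin N → ℝ} {x u v : E → Fin N → ℝ} {p : E}
    (hg : ∀ μ ν, DifferentiableAt ℝ (fun z => g z μ ν) (x p))
    (hx : DifferentiableAt ℝ x p) (hu : DifferentiableAt ℝ u p) (hv : DifferentiableAt ℝ v p) :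
    DifferentiableAt ℝ (fun q => contract₂ (g (x q)) (u q) (v q)) p ∧
    ∀ w, fderiv ℝ (fun q => contract₂ (g (x q)) (u q) (v q)) p w
      = contract₃ (fun ρ μ ν => pder (fun z => g z μ ν) ρ (x p)) (fderiv ℝ x p w) (u p) (v p)
        + contract₂ (g (x p)) (fderiv ℝ u p w) (v p)
        + contract₂ (g (x p)) (u p) (fderiv ℝ v p w) := by
  have key : ∀ μ ν, HasFDerivAt (fun q => g (x q) μ ν * u q μ * v q ν)
      _ p := fun μ ν =>
    (((hg μ ν).hasFDerivAt.comp p hx.hasFDerivAt).mul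
      (hasFDerivAt_pi'.mp hu.hasFDerivAt μ)).mul (hasFDerivAt_pi'.mp hv.hasFDerivAt ν)
  have tot := HasFDerivAt.fun_sum (u := Finset.univ) fun μ _ =>
    HasFDerivAt.fun_sum (u := Finset.univ) fun ν _ => key μ ν
  refine ⟨tot.differentiableAt, fun w => ?_⟩
  have hlin : ∀ μ ν, fderiv ℝ (fun z => g z μ ν) (x p) (fderiv ℝ x p w)
      = ∑ ρ, fderiv ℝ x p w ρ * pder (fun z => g z μ ν) ρ (x p) := by
    intro μ ν
    conv_lhs => rw [pi_eq_sum_univ' (fderiv ℝ x p w)]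
    simp [pder]
  unfold contract₂
  rw [tot.fderiv]
  have h3 : contract₃ (fun ρ μ ν => pder (fun z => g z μ ν) ρ (x p)) (fderiv ℝ x p w) (u p) (v p)
      = ∑ μ, ∑ ν, fderiv ℝ (fun z => g z μ ν) (x p) (fderiv ℝ x p w) * u p μ * v p ν := by
    rw [contract₃_eq_sum, Finset.sum_comm]
    refine Finset.sum_congr rfl fun μ _ => ?_
    rw [Finset.sum_comm]
    refine Finset.sum_congr rfl fun ν _ => ?_
    rw [hlin, Finset.sum_mul, Finset.sum_mul]
    refine Finset.sum_congr rfl fun ρ _ => ?_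
    ring
  rw [h3]
  simp only [← Finset.sum_add_distrib]
  simp only [sum_apply]
  refine Finset.sum_congr rfl fun μ _ => Finset.sum_congr rfl fun ν _ => ?_
  simp
  ring

/-- Lowering the upper index of the Christoffel symbols. -/
lemma sum_mul_christoffel {g : (Fin N → ℝ) → Fin N → Fin N → ℝ} {x : Fin N → ℝ}
    (hx : IsUnit (Matrix.of (g x)).det) (μ l σ : Fin N) :
    ∑ ν, g x μ ν * christoffel g x ν l σ
      = (1 / 2) * (pder (fun z => g z μ σ) l x + pder (fun z => g z μ l) σ x
          - pder (fun z => g z l σ) μ x) := by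
  have hinv : ∀ τ, ∑ ν, g x μ ν * ginv g x ν τ = if μ = τ then 1 else 0 := by
    intro τ
    rw [← Matrix.one_apply, ← Matrix.mul_nonsing_inv _ hx]
    rfl
  simp only [christoffel, Finset.mul_sum]
  rw [Finset.sum_comm]
  have : ∀ τ, ∑ ν, g x μ ν * (1 / 2 * (ginv g x ν τ *
      (pder (fun z => g z τ σ) l x + pder (fun z => g z τ l) σ x
          - pder (fun z => g z l σ) τ x)))
      = (if μ = τ then 1 else 0) * (1 / 2 * (pder (fun z => g z τ σ) l x
          + pder (fun z => g z τ l) σ x - pder (fun z => g z l σ) τ x)) := by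
    intro τ
    rw [← hinv, Finset.sum_mul]
    refine Finset.sum_congr rfl fun ν _ => ?_
    ring
  simp only [this]
  simp

/-- `Σ g_{μν} u^μ Γ^ν_{lσ} w^l v^σ` in terms of the derivatives of the metric. -/
lemma contract₂_christoffel {g : (Fin N → ℝ) → Fin N → Fin N → ℝ} {x : Fin N → ℝ}
    (hx : IsUnit (Matrix.of (g x)).det) (u w v : Fin N → ℝ) :
    contract₂ (g x) u (fun ν => ∑ l, ∑ σ, christoffel g x ν l σ * w l * v σ)
      = (1 / 2) * (contract₃ (fun ρ μ ν => pder (fun z => g z μ ν) ρ x) w u v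
          + contract₃ (fun ρ μ ν => pder (fun z => g z μ ν) ρ x) v u w
          - contract₃ (fun ρ μ ν => pder (fun z => g z μ ν) ρ x) u w v) := by
  have e1 : contract₂ (g x) u (fun ν => ∑ l, ∑ σ, christoffel g x ν l σ * w l * v σ)
      = ∑ μ, ∑ l, ∑ σ, (∑ ν, g x μ ν * christoffel g x ν l σ) * (u μ * w l * v σ) := by
    unfold contract₂
    refine Finset.sum_congr rfl fun μ _ => ?_
    simp only [Finset.mul_sum, Finset.sum_mul]
    rw [Finset.sum_comm]
    refine Finset.sum_congr rfl fun l _ => ?_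
    rw [Finset.sum_comm]
    refine Finset.sum_congr rfl fun σ _ => Finset.sum_congr rfl fun ν _ => ?_
    ring
  have e2 : contract₃ (fun ρ μ ν => pder (fun z => g z μ ν) ρ x) w u v
      = ∑ μ, ∑ l, ∑ σ, pder (fun z => g z μ σ) l x * (u μ * w l * v σ) := by
    rw [contract₃_eq_sum, Finset.sum_comm]
    refine Finset.sum_congr rfl fun μ _ => Finset.sum_congr rfl fun l _ =>
      Finset.sum_congr rfl fun σ _ => ?_
    ring
  have e3 : contract₃ (fun ρ μ ν => pder (fun z => g z μ ν) ρ x) v u w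
      = ∑ μ, ∑ l, ∑ σ, pder (fun z => g z μ l) σ x * (u μ * w l * v σ) := by
    rw [contract₃_eq_sum, Finset.sum_comm]
    refine Finset.sum_congr rfl fun μ _ => ?_
    rw [Finset.sum_comm]
    refine Finset.sum_congr rfl fun l _ => Finset.sum_congr rfl fun σ _ => ?_
    ring
  have e4 : contract₃ (fun ρ μ ν => pder (fun z => g z μ ν) ρ x) u w v
      = ∑ μ, ∑ l, ∑ σ, pder (fun z => g z l σ) μ x * (u μ * w l * v σ) := by
    rw [contract₃_eq_sum]
    refine Finset.sum_congr rfl fun μ _ => Finset.sum_congr rfl fun l _ =>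
      Finset.sum_congr rfl fun σ _ => ?_
    ring
  rw [e1, e2, e3, e4]
  simp only [sum_mul_christoffel hx, ← Finset.sum_add_distrib, ← Finset.sum_sub_distrib,
    Finset.mul_sum]
  refine Finset.sum_congr rfl fun μ _ => Finset.sum_congr rfl fun l _ =>
    Finset.sum_congr rfl fun σ _ => ?_
  ring

end TensorContractions

/-- The trace of `X^c ∂_c h_{ab} + ∂_a X^c h_{cb} + ∂_b X^c h_{ca} + f (K_{ab} + K_{ba})` with
respect to `h`. -/
lemma trace_variation {n : ℕ} {h : Matrix (Fin n) (Fin n) ℝ} (hsymm : h.transpose = h)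
    (hunit : IsUnit h.det) (K : Fin n → Fin n → ℝ) (dX : Fin n → Fin n → ℝ)
    (X : Fin n → ℝ) (dh : Fin n → Fin n → Fin n → ℝ) (f : ℝ) :
    (1 / 2) * ∑ a, ∑ b, h⁻¹ a b * ((∑ c, X c * dh c b a)
        + (∑ c, (dX c b * h c a + dX c a * h c b)) + f * (K b a + K a b))
      = f * (∑ a, ∑ b, h⁻¹ a b * K a b)
        + ((∑ a, dX a a) + (1 / 2) * ∑ a, ∑ b, ∑ c, h⁻¹ a b * X c * dh c a b) := by
  have hI : ∀ a b, h⁻¹ a b = h⁻¹ b a := fun a b => by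
    conv_lhs => rw [← hsymm, ← Matrix.transpose_nonsing_inv]
    rfl
  have hmul : ∀ c a, ∑ b, h c b * h⁻¹ b a = if c = a then 1 else 0 := fun c a => by
    rw [← Matrix.one_apply, ← Matrix.mul_nonsing_inv _ hunit, Matrix.mul_apply]
  have hX : ∑ a, ∑ b, h⁻¹ a b * ∑ c, dX c a * h c b = ∑ a, dX a a := by
    have : ∀ a, ∑ b, h⁻¹ a b * ∑ c, dX c a * h c b = dX a a := by
      intro a
      calc _ = ∑ c, dX c a * ∑ b, h c b * h⁻¹ b a := by
            simp only [Finset.mul_sum]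
            rw [Finset.sum_comm]
            refine Finset.sum_congr rfl fun c _ => Finset.sum_congr rfl fun b _ => ?_
            rw [hI a b]; ring
        _ = _ := by simp [hmul]
    exact Finset.sum_congr rfl fun a _ => this a
  have hX' : ∑ a, ∑ b, h⁻¹ a b * ∑ c, dX c b * h c a = ∑ a, dX a a := by
    rw [← hX, Finset.sum_comm]
    refine Finset.sum_congr rfl fun a _ => Finset.sum_congr rfl fun b _ => ?_
    rw [hI a b]
  have hK : ∑ a, ∑ b, h⁻¹ a b * K b a = ∑ a, ∑ b, h⁻¹ a b * K a b := by
    rw [Finset.sum_comm]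
    refine Finset.sum_congr rfl fun a _ => Finset.sum_congr rfl fun b _ => ?_
    rw [hI a b]
  have hdh : ∑ a, ∑ b, h⁻¹ a b * ∑ c, X c * dh c b a
      = ∑ a, ∑ b, ∑ c, h⁻¹ a b * X c * dh c a b := by
    rw [Finset.sum_comm]
    refine Finset.sum_congr rfl fun a _ => Finset.sum_congr rfl fun b _ => ?_
    simp only [hI b a, Finset.mul_sum, mul_assoc]
  have hf : ∀ L : Fin n → Fin n → ℝ,
      ∑ a, ∑ b, h⁻¹ a b * (f * L a b) = f * ∑ a, ∑ b, h⁻¹ a b * L a b := fun L => by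
    simp only [Finset.mul_sum]
    refine Finset.sum_congr rfl fun a _ => Finset.sum_congr rfl fun b _ => ?_
    ring
  simp only [mul_add, Finset.sum_add_distrib]
  rw [hf K, hf fun a b => K b a, hK, hX, hX', hdh]
  ring

/-- Lemma 5.5 (2) of the paper, in local coordinates: the first
variation of the induced volume factor is
`∂_t √|det h_t||_{t=0} = √|det h| (f k + div^Σ X)`. -/
theorem first_variation_induced_volume
    (n : ℕ) (hn : 1 ≤ n)
    (U : Set (Fin n → ℝ)) (hU : IsOpen U)
    (V : Set (Fin (n + 1) → ℝ)) (hV : IsOpen V)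
    (g : (Fin (n + 1) → ℝ) → Fin (n + 1) → Fin (n + 1) → ℝ)
    (hg : ∀ μ ν, ContDiffOn ℝ (⊤ : ℕ∞) (fun x => g x μ ν) V)
    (hgsym : ∀ x ∈ V, ∀ μ ν, g x μ ν = g x ν μ)
    (hgunit : ∀ x ∈ V, IsUnit (Matrix.of (g x)).det)
    (δ : ℝ) (hδ : 0 < δ)
    (φ : ℝ → (Fin n → ℝ) → Fin (n + 1) → ℝ)
    (hφ : ∀ μ, ContDiffOn ℝ (⊤ : ℕ∞) (fun q : ℝ × (Fin n → ℝ) => φ q.1 q.2 μ)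
      (Set.Ioo (-δ) δ ×ˢ U))
    (hφV : ∀ t ∈ Set.Ioo (-δ) δ, ∀ y ∈ U, φ t y ∈ V)
    (himm : ∀ t ∈ Set.Ioo (-δ) δ, ∀ y ∈ U, ∀ v : Fin n → ℝ,
      (∀ μ, (∑ a, v a * Dphi φ t y a μ) = 0) → v = 0)
    (nrm : ℝ → (Fin n → ℝ) → Fin (n + 1) → ℝ)
    (hnrm : ∀ μ, ContDiffOn ℝ (⊤ : ℕ∞) (fun q : ℝ × (Fin n → ℝ) => nrm q.1 q.2 μ)
      (Set.Ioo (-δ) δ ×ˢ U))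
    (ϵ : ℝ) (hϵ : ϵ = 1 ∨ ϵ = -1)
    (horth : ∀ t ∈ Set.Ioo (-δ) δ, ∀ y ∈ U, ∀ a : Fin n,
      (∑ μ, ∑ ν, g (φ t y) μ ν * nrm t y μ * Dphi φ t y a ν) = 0)
    (hunit : ∀ t ∈ Set.Ioo (-δ) δ, ∀ y ∈ U,
      (∑ μ, ∑ ν, g (φ t y) μ ν * nrm t y μ * nrm t y ν) = ϵ)
    (f : (Fin n → ℝ) → ℝ) (hf : ContDiffOn ℝ (⊤ : ℕ∞) f U)
    (X : (Fin n → ℝ) → Fin n → ℝ) (hX : ∀ a, ContDiffOn ℝ (⊤ : ℕ∞) (fun y => X y a) U)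
    (hdec : ∀ y ∈ U, ∀ μ, deriv (fun t => φ t y μ) 0
      = f y * nrm 0 y μ + ∑ a, X y a * Dphi φ 0 y a μ)
    (hh0 : ∀ y ∈ U, IsUnit (Matrix.of (fun a b => indMet g φ 0 y a b)).det) :
    ∀ y ∈ U,
      deriv (fun t => Real.sqrt |(Matrix.of (fun a b => indMet g φ t y a b)).det|) 0
        = Real.sqrt |(Matrix.of (fun a b => indMet g φ 0 y a b)).det|
            * (f y * trExtK g φ nrm 0 y
              + ((∑ a, pder (fun z => X z a) a y)
                + (1 / 2) * ∑ a, ∑ b, ∑ c, indMetInv g φ 0 y a b * X y c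
                    * pder (fun z => indMet g φ 0 z a b) c y)) := by
  intro y hy
  have h0 : (0 : ℝ) ∈ Set.Ioo (-δ) δ := ⟨by linarith, hδ⟩
  have hopen : IsOpen (Set.Ioo (-δ) δ ×ˢ U) := isOpen_Ioo.prod hU
  have hφat : ∀ z ∈ U, ∀ μ,
      ContDiffAt ℝ 2 (fun q : ℝ × (Fin n → ℝ) => φ q.1 q.2 μ) (0, z) := fun z hz μ =>
    contDiffAt_infty.mp ((hφ μ).contDiffAt (hopen.mem_nhds ⟨h0, hz⟩)) 2
  have hφsl : ∀ μ, ContDiffAt ℝ 2 (fun z => φ 0 z μ) y := fun μ =>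
    contDiffAt_slice_right (hφat y hy μ)
  have hgd : ∀ μ ν, DifferentiableAt ℝ (fun z => g z μ ν) (φ 0 y) := fun μ ν =>
    ((hg μ ν).contDiffAt (hV.mem_nhds (hφV 0 h0 y hy))).differentiableAt (by simp)
  have hfd : DifferentiableAt ℝ f y :=
    (hf.contDiffAt (hU.mem_nhds hy)).differentiableAt (by simp)
  have hXd : ∀ c, DifferentiableAt ℝ (fun z => X z c) y := fun c =>
    ((hX c).contDiffAt (hU.mem_nhds hy)).differentiableAt (by simp)
  have hNd : ∀ μ, DifferentiableAt ℝ (fun z => nrm 0 z μ) y := fun μ =>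
    (contDiffAt_slice_right (F := fun q : ℝ × (Fin n → ℝ) => nrm q.1 q.2 μ)
      ((hnrm μ).contDiffAt (hopen.mem_nhds ⟨h0, hy⟩))).differentiableAt (by simp)
  have hDd : ∀ a μ, DifferentiableAt ℝ (fun z => Dphi φ 0 z a μ) y := fun a μ =>
    differentiableAt_fderiv_apply (hφsl μ) _
  -- the time derivatives of `φ` and of its spatial derivatives
  have hφt : ∀ z ∈ U, ∀ μ, HasDerivAt (fun t => φ t z μ)
      (f z * nrm 0 z μ + ∑ a, X z a * Dphi φ 0 z a μ) 0 := fun z hz μ => by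
    rw [← hdec z hz μ]
    exact (hasDerivAt_slice_left ((hφat z hz μ).differentiableAt
      (by norm_num))).differentiableAt.hasDerivAt
  have hDt : ∀ a μ, HasDerivAt (fun t => Dphi φ t y a μ)
      (pder f a y * nrm 0 y μ + f y * pder (fun z => nrm 0 z μ) a y
        + ∑ c, (pder (fun z => X z c) a y * Dphi φ 0 y c μ
          + X y c * pder (fun z => Dphi φ 0 z a μ) c y)) 0 := fun a μ => by
    refine (hasDerivAt_fderiv_slice (hφat y hy μ) (Pi.single a 1)).congr_deriv ?_
    have hev : (fun z => deriv (fun s => φ s z μ) 0)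
        =ᶠ[nhds y] fun z => f z * nrm 0 z μ + ∑ a, X z a * Dphi φ 0 z a μ :=
      Filter.eventually_of_mem (hU.mem_nhds hy) fun z hz => hdec z hz μ
    rw [hev.fderiv_eq, ((hfd.hasFDerivAt.fun_mul (hNd μ).hasFDerivAt).fun_add
      (HasFDerivAt.fun_sum fun c _ =>
        (hXd c).hasFDerivAt.fun_mul (hDd c μ).hasFDerivAt)).fderiv]
    have hcomm : ∀ c, pder (fun z => Dphi φ 0 z a μ) c y
        = fderiv ℝ (fun z => Dphi φ 0 z c μ) y (Pi.single a 1) := fun c =>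
      fderiv_fderiv_apply_comm (hφsl μ) _ _
    simp only [hcomm]
    simp only [add_apply, sum_apply, smul_apply, smul_eq_mul, pder]
    congr 1
    · ring
    · exact Finset.sum_congr rfl fun c _ => by ring
  set G := g (φ 0 y) with hG
  set D : Fin (n + 1) → Fin (n + 1) → Fin (n + 1) → ℝ :=
    fun ρ μ ν => pder (fun z => g z μ ν) ρ (φ 0 y) with hD
  set e : Fin n → Fin (n + 1) → ℝ := fun a => Dphi φ 0 y a with he
  set N : Fin (n + 1) → ℝ := nrm 0 y with hN
  set dN : Fin n → Fin (n + 1) → ℝ := fun a μ => pder (fun z => nrm 0 z μ) a y with hdN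
  set S : Fin n → Fin n → Fin (n + 1) → ℝ :=
    fun a c μ => pder (fun z => Dphi φ 0 z a μ) c y with hS
  set dX : Fin n → Fin n → ℝ := fun c a => pder (fun z => X z c) a y with hdX
  have hGs : ∀ μ ν, G μ ν = G ν μ := hgsym _ (hφV 0 h0 y hy)
  have hDs : ∀ ρ μ ν, D ρ μ ν = D ρ ν μ := fun ρ μ ν => by
    have hev : (fun z => g z μ ν) =ᶠ[nhds (φ 0 y)] fun z => g z ν μ :=
      Filter.eventually_of_mem (hV.mem_nhds (hφV 0 h0 y hy)) fun z hz => hgsym z hz μ ν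
    simp only [hD, pder, hev.fderiv_eq]
  have hNe : ∀ a, contract₂ G N (e a) = 0 := horth 0 h0 y hy
  have hh : ∀ a b, indMet g φ 0 y a b = contract₂ G (e a) (e b) := fun a b => rfl
  -- the spatial derivatives of the induced metric
  have hdh : ∀ c a b, pder (fun z => indMet g φ 0 z a b) c y
      = contract₃ D (e c) (e a) (e b) + contract₂ G (S a c) (e b)
        + contract₂ G (e a) (S b c) := fun c a b => by
    have hd : ∀ a, DifferentiableAt ℝ (fun z => Dphi φ 0 z a) y := fun a =>
      differentiableAt_pi.mpr (hDd a)
    have hφd : DifferentiableAt ℝ (φ 0) y :=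
      differentiableAt_pi.mpr fun μ => (hφsl μ).differentiableAt (by norm_num)
    have h1 := (differentiableAt_and_fderiv_contract₂ hgd hφd (hd a) (hd b)).2 (Pi.single c 1)
    have e1 : fderiv ℝ (φ 0) y (Pi.single c 1) = e c := by
      ext μ; exact (DFunLike.congr_fun (fderiv_apply hφd μ) _).symm
    have e2 : ∀ a, fderiv ℝ (fun z => Dphi φ 0 z a) y (Pi.single c 1) = S a c := fun a => by
      ext μ; exact (DFunLike.congr_fun (fderiv_apply (hd a) μ) _).symm
    rw [e1, e2, e2] at h1
    exact h1
  -- the time derivative of the induced metric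
  have hht : ∀ a b, HasDerivAt (fun t => indMet g φ t y a b)
      ((∑ c, X y c * pder (fun z => indMet g φ 0 z a b) c y)
        + (∑ c, (dX c a * indMet g φ 0 y c b + dX c b * indMet g φ 0 y c a))
        + f y * (extK g φ nrm 0 y a b + extK g φ nrm 0 y b a)) 0 := fun a b => by
    have hW : HasDerivAt (fun t => φ t y) (f y • N + ∑ c, X y c • e c) 0 :=
      hasDerivAt_pi.mpr fun μ => (hφt y hy μ).congr_deriv (by simp [Finset.sum_apply, he, hN])
    have hT : ∀ a, HasDerivAt (fun t => Dphi φ t y a)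
        (pder f a y • N + f y • dN a + ∑ c, (dX c a • e c + X y c • S a c)) 0 := fun a =>
      hasDerivAt_pi.mpr fun μ => (hDt a μ).congr_deriv
        (by simp [Finset.sum_apply, he, hN, hdN, hS, hdX])
    obtain ⟨h1, h2⟩ := differentiableAt_and_fderiv_contract₂ (x := fun t => φ t y) hgd
      hW.differentiableAt (hT a).differentiableAt (hT b).differentiableAt
    refine (h1.hasDerivAt).congr_deriv ?_
    rw [← fderiv_apply_one_eq_deriv, h2 1]
    simp only [fderiv_apply_one_eq_deriv, hW.deriv, (hT _).deriv]
    have hK : ∀ a b, extK g φ nrm 0 y a b = contract₂ G (dN b) (e a)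
        + (1 / 2) * (contract₃ D (e b) (e a) N + contract₃ D N (e a) (e b)
          - contract₃ D (e a) (e b) N) := fun a b => by
      rw [← contract₂_christoffel (hgunit _ (hφV 0 h0 y hy)), contract₂_comm hGs (e a),
        ← contract₂_add_left, contract₂_comm hGs]
      rfl
    change contract₃ D _ (e a) (e b) + contract₂ G _ (e b) + contract₂ G (e a) _ = _
    rw [contract₂_comm hGs (e a)]
    simp only [hK, hdh, hh, contract₃_add_left, contract₃_smul_left, contract₃_sum_left,
      contract₂_add_left, contract₂_smul_left, contract₂_sum_left, hNe,
      mul_add, Finset.sum_add_distrib]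
    rw [contract₃_comm_right hDs N (e b) (e a)]
    simp only [contract₂_comm hGs (e a) (S b _)]
    ring
  have hhs : ∀ a b, indMet g φ 0 y a b = indMet g φ 0 y b a := fun a b =>
    contract₂_comm hGs (e a) (e b)
  rw [(hasDerivAt_sqrt_abs_det (M := fun t => Matrix.of fun a b => indMet g φ t y a b)
    (M' := Matrix.of fun a b => _) (hh0 y hy) hht).deriv]
  congr 1
  exact trace_variation (h := Matrix.of fun a b => indMet g φ 0 y a b)
    (Matrix.ext fun a b => hhs b a) (hh0 y hy) (extK g φ nrm 0 y) dX (X y)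
    (fun c a b => pder (fun z => indMet g φ 0 z a b) c y) (f y)
end
end

section
/- In the coordinate hypersurface-variation setup, let (K_t)_{ab} := Σ_{μ,ν} g_{μν}(φ_t) ∂_aφ_t^μ (∂_b n_t^ν + Σ_{λ,σ} Γ^ν_{λσ}(φ_t) ∂_bφ_t^λ n_t^σ) be the extrinsic curvature of φ_t with normal n_t. Define the curvature components R^λ_{αμβ} := ∂_μ Γ^λ_{αβ} − ∂_β Γ^λ_{αμ} + Σ_σ ( Γ^λ_{σμ} Γ^σ_{αβ} − Γ^λ_{σβ} Γ^σ_{αμ} ) and R_{μανβ} := Σ_λ g_{μλ} R^λ_{ανβ}, let Γ^{Σ,c}_{ab} := (1/2) Σ_d h^{cd} ( ∂_a h_{db} + ∂_b h_{da} − ∂_d h_{ab} ) be the Christoffel symbols of h := h₀, let (∇^Σ df)_{ab} := ∂_a ∂_b f − Σ_c Γ^{Σ,c}_{ab} ∂_c f, and let (£_X K)_{ab} := Σ_c ( X^c ∂_c K_{ab} + K_{cb} ∂_a X^c + K_{ac} ∂_b X^c ). Then at every point of U, ∂_t (K_t)_{ab} |_{t=0} = f Σ_{e,f'} K_{ae}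 h^{ef'} K_{f'b} − f Σ_{μ,α,ν,β} R_{μανβ}(φ₀) n₀^μ ∂_aφ₀^α n₀^ν ∂_bφ₀^β − ϵ (∇^Σ df)_{ab} + (£_X K)_{ab}. -/
noncomputable section

section Calculus

variable {E : Type*} [NormedAddCommGroup E] [NormedSpace ℝ E]

theorem fderiv_apply_mul {F G : E → ℝ} {p : E} (hF : DifferentiableAt ℝ F p)
    (hG : DifferentiableAt ℝ G p) (v : E) :
    fderiv ℝ (fun q => F q * G q) p v = fderiv ℝ F p v * G p + F p * fderiv ℝ G p v := by
  rw [fderiv_fun_mul hF hG]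
  simp [mul_comm]
  ring

theorem fderiv_apply_add {F G : E → ℝ} {p : E} (hF : DifferentiableAt ℝ F p)
    (hG : DifferentiableAt ℝ G p) (v : E) :
    fderiv ℝ (fun q => F q + G q) p v = fderiv ℝ F p v + fderiv ℝ G p v := by
  rw [fderiv_fun_add hF hG]; rfl

theorem fderiv_apply_sum {ι : Type*} {s : Finset ι} {F : ι → E → ℝ} {p : E}
    (hF : ∀ i ∈ s, DifferentiableAt ℝ (F i) p) (v : E) :
    fderiv ℝ (fun q => ∑ i ∈ s, F i q) p v = ∑ i ∈ s, fderiv ℝ (F i) p v := by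
  rw [fderiv_fun_sum hF, _root_.sum_apply]

theorem fderiv_eq_of_eqOn {F G : E → ℝ} {W : Set E} (hW : IsOpen W) (h : Set.EqOn F G W)
    {p : E} (hp : p ∈ W) : fderiv ℝ F p = fderiv ℝ G p :=
  (h.eventuallyEq_of_mem (hW.mem_nhds hp)).fderiv_eq

theorem ContDiffOn.differentiableAt_of_isOpen {F : E → ℝ} {W : Set E} (hW : IsOpen W)
    (hF : ContDiffOn ℝ (⊤ : ℕ∞) F W) {p : E} (hp : p ∈ W) : DifferentiableAt ℝ F p :=
  (hF.contDiffAt (hW.mem_nhds hp)).differentiableAt (by simp)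

theorem ContDiffOn.fderiv_apply_const {F : E → ℝ} {W : Set E} (hW : IsOpen W)
    (hF : ContDiffOn ℝ (⊤ : ℕ∞) F W) (v : E) :
    ContDiffOn ℝ (⊤ : ℕ∞) (fun q => fderiv ℝ F q v) W :=
  (hF.fderiv_of_isOpen hW (by simp)).clm_apply contDiffOn_const

theorem fderiv_fderiv_comm {F : E → ℝ} {W : Set E} (hW : IsOpen W)
    (hF : ContDiffOn ℝ (⊤ : ℕ∞) F W) {p : E} (hp : p ∈ W) (v w : E) :
    fderiv ℝ (fun q => fderiv ℝ F q w) p v = fderiv ℝ (fun q => fderiv ℝ F q v) p w := by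
  have hd : DifferentiableAt ℝ (fderiv ℝ F) p :=
    ((hF.fderiv_of_isOpen (m := (⊤ : ℕ∞)) hW (by simp)).contDiffAt
      (hW.mem_nhds hp)).differentiableAt (by simp)
  have hs : IsSymmSndFDerivAt ℝ F p :=
    (hF.contDiffAt (hW.mem_nhds hp)).isSymmSndFDerivAt (by
      rw [minSmoothness_of_isRCLikeNormedField]
      exact WithTop.coe_le_coe.2 (le_top : (2 : ℕ∞) ≤ ⊤))
  rw [fderiv_clm_apply hd (differentiableAt_const _),
    fderiv_clm_apply hd (differentiableAt_const _)]
  simpa using hs v w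

theorem fderiv_comp_eq_sum_pder {N : ℕ} {F : (Fin N → ℝ) → ℝ} {Φ : E → Fin N → ℝ} {p : E}
    (hF : DifferentiableAt ℝ F (Φ p)) (hΦ : ∀ μ, DifferentiableAt ℝ (fun q => Φ q μ) p)
    (v : E) :
    fderiv ℝ (fun q => F (Φ q)) p v
      = ∑ ρ, pder F ρ (Φ p) * fderiv ℝ (fun q => Φ q ρ) p v := by
  have hΦ' : DifferentiableAt ℝ Φ p := differentiableAt_pi.2 hΦ
  have h1 : fderiv ℝ (fun q => F (Φ q)) p v = fderiv ℝ F (Φ p) (fderiv ℝ Φ p v) := by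
    rw [show (fun q => F (Φ q)) = F ∘ Φ from rfl, fderiv_comp p hF hΦ']; rfl
  have h2 : ∀ ρ, fderiv ℝ Φ p v ρ = fderiv ℝ (fun q => Φ q ρ) p v := fun ρ => by
    rw [fderiv_pi hΦ]; rfl
  rw [h1, ← ContinuousLinearMap.coe_coe, LinearMap.pi_apply_eq_sum_univ]
  refine Finset.sum_congr rfl fun ρ _ => ?_
  have h3 : (fun j => if ρ = j then 1 else 0) = (Pi.single ρ 1 : Fin N → ℝ) := by
    ext j
    simp [Pi.single_apply, eq_comm]
  rw [h2, smul_eq_mul, mul_comm, pder, h3]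
  rfl

theorem contDiffOn_det {m : ℕ} {W : Set E} {M : E → Matrix (Fin m) (Fin m) ℝ}
    (hM : ∀ i j, ContDiffOn ℝ (⊤ : ℕ∞) (fun q => M q i j) W) :
    ContDiffOn ℝ (⊤ : ℕ∞) (fun q => (M q).det) W := by
  simp only [Matrix.det_apply']
  exact ContDiffOn.sum fun s _ => contDiffOn_const.mul
    (contDiffOn_prod fun i _ => hM _ _)

theorem contDiffOn_matrix_inv {m : ℕ} {W : Set E} {M : E → Matrix (Fin m) (Fin m) ℝ}
    (hM : ∀ i j, ContDiffOn ℝ (⊤ : ℕ∞) (fun q => M q i j) W)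
    (hdet : ∀ q ∈ W, IsUnit (M q).det) (i j : Fin m) :
    ContDiffOn ℝ (⊤ : ℕ∞) (fun q => (M q)⁻¹ i j) W := by
  simp only [Matrix.inv_def, Ring.inverse_eq_inv', Matrix.smul_apply, smul_eq_mul,
    Matrix.adjugate_apply]
  refine ((contDiffOn_det hM).inv fun q hq => (hdet q hq).ne_zero).mul (contDiffOn_det ?_)
  intro k l
  by_cases hk : k = j
  · subst hk
    simpa using contDiffOn_const
  · simpa [Matrix.updateRow_ne hk] using hM k l

end Calculus

section CovariantDerivative

/-- `g` is a smooth pseudo-Riemannian metric on the open set `V`. -/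
structure IsMetricOn {N : ℕ} (g : (Fin N → ℝ) → Fin N → Fin N → ℝ)
    (V : Set (Fin N → ℝ)) : Prop where
  isOpen : IsOpen V
  smooth : ∀ μ ν, ContDiffOn ℝ (⊤ : ℕ∞) (fun x => g x μ ν) V
  symm : ∀ x ∈ V, ∀ μ ν, g x μ ν = g x ν μ
  isUnit_det : ∀ x ∈ V, IsUnit (Matrix.of (g x)).det

/-- The bilinear form `g_{μν}(x) A^μ B^ν`. -/
def metForm {N : ℕ} (g : (Fin N → ℝ) → Fin N → Fin N → ℝ) (x : Fin N → ℝ) :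
    LinearMap.BilinForm ℝ (Fin N → ℝ) :=
  Matrix.toBilin' (Matrix.of (g x))

theorem metForm_apply {N : ℕ} (g : (Fin N → ℝ) → Fin N → Fin N → ℝ) (x A B : Fin N → ℝ) :
    metForm g x A B = ∑ μ, ∑ ν, g x μ ν * A μ * B ν := by
  simp only [metForm, Matrix.toBilin'_apply, Matrix.of_apply]
  exact Finset.sum_congr rfl fun μ _ => Finset.sum_congr rfl fun ν _ => by ring

variable {N : ℕ} {g : (Fin N → ℝ) → Fin N → Fin N → ℝ} {V : Set (Fin N → ℝ)}

namespace IsMetricOn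

theorem metForm_comm (hg : IsMetricOn g V) {x : Fin N → ℝ} (hx : x ∈ V) (A B : Fin N → ℝ) :
    metForm g x A B = metForm g x B A := by
  rw [metForm_apply, metForm_apply, Finset.sum_comm]
  refine Finset.sum_congr rfl fun μ _ => Finset.sum_congr rfl fun ν _ => ?_
  rw [hg.symm x hx ν μ]; ring

theorem eq_zero_of_metForm (hg : IsMetricOn g V) {x : Fin N → ℝ} (hx : x ∈ V)
    {A : Fin N → ℝ} (h : ∀ B, metForm g x A B = 0) : A = 0 := by
  refine Matrix.eq_zero_of_vecMul_eq_zero (hg.isUnit_det x hx).ne_zero ?_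
  ext ν
  have := h (Pi.single ν 1)
  rw [metForm_apply] at this
  simpa [Matrix.vecMul, dotProduct, Pi.single_apply, mul_comm] using this

theorem pder_symm (hg : IsMetricOn g V) {x : Fin N → ℝ} (hx : x ∈ V) (μ ν ρ : Fin N) :
    pder (fun z => g z μ ν) ρ x = pder (fun z => g z ν μ) ρ x := by
  unfold pder
  rw [fderiv_eq_of_eqOn hg.isOpen (fun z hz => hg.symm z hz μ ν) hx]

theorem christoffel_symm (hg : IsMetricOn g V) {x : Fin N → ℝ} (hx : x ∈ V)
    (l μ ν : Fin N) : christoffel g x l μ ν = christoffel g x l ν μ := by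
  unfold christoffel
  congr 1
  refine Finset.sum_congr rfl fun σ _ => ?_
  rw [hg.pder_symm hx μ ν σ]; ring

theorem pder_christoffel_symm (hg : IsMetricOn g V) {x : Fin N → ℝ} (hx : x ∈ V)
    (l μ ν ρ : Fin N) : pder (fun z => christoffel g z l μ ν) ρ x
      = pder (fun z => christoffel g z l ν μ) ρ x := by
  unfold pder
  rw [fderiv_eq_of_eqOn hg.isOpen (fun z hz => hg.christoffel_symm hz l μ ν) hx]

theorem contDiffOn_christoffel (hg : IsMetricOn g V) (l μ ν : Fin N) :
    ContDiffOn ℝ (⊤ : ℕ∞) (fun z => christoffel g z l μ ν) V := by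
  have h : ∀ μ ν ρ, ContDiffOn ℝ (⊤ : ℕ∞) (fun z => pder (fun z => g z μ ν) ρ z) V :=
    fun μ ν ρ => (hg.smooth μ ν).fderiv_apply_const hg.isOpen _
  unfold christoffel
  refine contDiffOn_const.mul (ContDiffOn.sum fun σ _ => ?_)
  exact (contDiffOn_matrix_inv (M := fun z => Matrix.of (g z)) hg.smooth hg.isUnit_det l σ).mul
    (((h _ _ _).add (h _ _ _)).sub (h _ _ _))

theorem sum_mul_christoffel (hg : IsMetricOn g V) {x : Fin N → ℝ} (hx : x ∈ V)
    (σ μ ν : Fin N) : ∑ l, g x σ l * christoffel g x l μ ν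
      = (1 / 2) * (pder (fun z => g z σ ν) μ x + pder (fun z => g z σ μ) ν x
        - pder (fun z => g z μ ν) σ x) := by
  have h : ∀ τ, ∑ l, g x σ l * ginv g x l τ = if σ = τ then 1 else 0 := fun τ => by
    have := congrFun (congrFun (Matrix.mul_nonsing_inv _ (hg.isUnit_det x hx)) σ) τ
    simpa [Matrix.mul_apply, Matrix.one_apply, ginv] using this
  unfold christoffel
  calc _ = (1 / 2) * ∑ τ, (∑ l, g x σ l * ginv g x l τ) *
      (pder (fun z => g z τ ν) μ x + pder (fun z => g z τ μ) ν x
        - pder (fun z => g z μ ν) τ x) := by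
        simp only [Finset.mul_sum, Finset.sum_mul]
        rw [Finset.sum_comm]
        exact Finset.sum_congr rfl fun _ _ => Finset.sum_congr rfl fun _ _ => by ring
    _ = _ := by simp [h]

theorem pder_eq_sum_christoffel (hg : IsMetricOn g V) {x : Fin N → ℝ} (hx : x ∈ V)
    (ρ μ ν : Fin N) : pder (fun z => g z μ ν) ρ x
      = ∑ l, g x μ l * christoffel g x l ρ ν + ∑ l, g x ν l * christoffel g x l ρ μ := by
  rw [hg.sum_mul_christoffel hx, hg.sum_mul_christoffel hx, hg.pder_symm hx ν μ,
    hg.pder_symm hx ρ μ, hg.pder_symm hx ν ρ]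
  ring

end IsMetricOn

variable {E : Type*} [NormedAddCommGroup E] [NormedSpace ℝ E] {W : Set E}

/-- A vector-valued map with smooth components on `W`. -/
def SmoothField (A : E → Fin N → ℝ) (W : Set E) : Prop :=
  ∀ μ, ContDiffOn ℝ (⊤ : ℕ∞) (fun q => A q μ) W

/-- The velocity `∂_v Φ` of `Φ` in the direction `v`. -/
def vel (Φ : E → Fin N → ℝ) (v p : E) (μ : Fin N) : ℝ := fderiv ℝ (fun q => Φ q μ) p v

/-- The covariant derivative along `Φ` in the direction `v` of a vector field `A` along `Φ`. -/
def covD (g : (Fin N → ℝ) → Fin N → Fin N → ℝ) (Φ A : E → Fin N → ℝ) (v p : E)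
    (ν : Fin N) : ℝ :=
  fderiv ℝ (fun q => A q ν) p v
    + ∑ l, ∑ σ, christoffel g (Φ p) ν l σ * vel Φ v p l * A p σ

/-- The curvature operator `R(X, Y) A`, linear in `X`. -/
def curvOp (g : (Fin N → ℝ) → Fin N → Fin N → ℝ) (x Y A : Fin N → ℝ) :
    (Fin N → ℝ) →ₗ[ℝ] (Fin N → ℝ) where
  toFun X ν := ∑ α, ∑ μ, ∑ β, riemann g x ν α μ β * A α * X μ * Y β
  map_add' X X' := by
    ext ν
    simp only [Pi.add_apply, ← Finset.sum_add_distrib]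
    exact Finset.sum_congr rfl fun _ _ => Finset.sum_congr rfl fun _ _ =>
      Finset.sum_congr rfl fun _ _ => by ring
  map_smul' c X := by
    ext ν
    simp only [Pi.smul_apply, smul_eq_mul, RingHom.id_apply, Finset.mul_sum]
    exact Finset.sum_congr rfl fun _ _ => Finset.sum_congr rfl fun _ _ =>
      Finset.sum_congr rfl fun _ _ => by ring

theorem curvOp_apply (g : (Fin N → ℝ) → Fin N → Fin N → ℝ) (x Y A X : Fin N → ℝ) (ν : Fin N) :
    curvOp g x Y A X ν = ∑ α, ∑ μ, ∑ β, riemann g x ν α μ β * A α * X μ * Y β :=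
  rfl

theorem SmoothField.vel {Φ : E → Fin N → ℝ} (hW : IsOpen W) (hΦ : SmoothField Φ W) (v : E) :
    SmoothField (vel Φ v) W :=
  fun μ => (hΦ μ).fderiv_apply_const hW v

theorem SmoothField.differentiableAt {A : E → Fin N → ℝ} (hA : SmoothField A W)
    (hW : IsOpen W) {p : E} (hp : p ∈ W) (μ : Fin N) :
    DifferentiableAt ℝ (fun q => A q μ) p :=
  (hA μ).differentiableAt_of_isOpen hW hp

theorem ContDiffOn.comp_field {F : (Fin N → ℝ) → ℝ} {Φ : E → Fin N → ℝ}
    (hF : ContDiffOn ℝ (⊤ : ℕ∞) F V) (hΦ : SmoothField Φ W) (hΦV : Set.MapsTo Φ W V) :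
    ContDiffOn ℝ (⊤ : ℕ∞) (fun q => F (Φ q)) W :=
  hF.comp (contDiffOn_pi.2 hΦ) hΦV

theorem smoothField_covD (hg : IsMetricOn g V) {Φ A : E → Fin N → ℝ} (hW : IsOpen W)
    (hΦ : SmoothField Φ W) (hΦV : Set.MapsTo Φ W V) (hA : SmoothField A W) (v : E) :
    SmoothField (covD g Φ A v) W := fun ν =>
  ((hA ν).fderiv_apply_const hW v).add (ContDiffOn.sum fun l _ => ContDiffOn.sum fun σ _ =>
    (((hg.contDiffOn_christoffel ν l σ).comp_field hΦ hΦV).mul (hΦ.vel hW v l)).mul (hA σ))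

theorem contDiffOn_metForm (hg : IsMetricOn g V) {Φ A B : E → Fin N → ℝ}
    (hΦ : SmoothField Φ W) (hΦV : Set.MapsTo Φ W V) (hA : SmoothField A W)
    (hB : SmoothField B W) :
    ContDiffOn ℝ (⊤ : ℕ∞) (fun q => metForm g (Φ q) (A q) (B q)) W := by
  simp only [metForm_apply]
  exact ContDiffOn.sum fun μ _ => ContDiffOn.sum fun ν _ =>
    (((hg.smooth μ ν).comp_field hΦ hΦV).mul (hA μ)).mul (hB ν)

theorem sum_comm_outer_inner {ι : Type*} [Fintype ι] (F : ι → ι → ι → ℝ) :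
    ∑ a, ∑ b, ∑ c, F a b c = ∑ c, ∑ b, ∑ a, F a b c := by
  rw [Finset.sum_comm]
  simp_rw [Finset.sum_comm (f := fun a c => F a _ c)]
  rw [Finset.sum_comm]

theorem fderiv_metForm (hg : IsMetricOn g V) {Φ A B : E → Fin N → ℝ} (hW : IsOpen W)
    (hΦ : SmoothField Φ W) (hΦV : Set.MapsTo Φ W V) (hA : SmoothField A W)
    (hB : SmoothField B W) {p : E} (hp : p ∈ W) (v : E) :
    fderiv ℝ (fun q => metForm g (Φ q) (A q) (B q)) p v
      = metForm g (Φ p) (covD g Φ A v p) (B p) + metForm g (Φ p) (A p) (covD g Φ B v p) := by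
  have dg : ∀ μ ν, DifferentiableAt ℝ (fun q => g (Φ q) μ ν) p := fun μ ν =>
    ((hg.smooth μ ν).comp_field hΦ hΦV).differentiableAt_of_isOpen hW hp
  have dA := hA.differentiableAt hW hp
  have dB := hB.differentiableAt hW hp
  have hd : ∀ μ ν, fderiv ℝ (fun q => g (Φ q) μ ν * A q μ * B q ν) p v
      = g (Φ p) μ ν * fderiv ℝ (fun q => A q μ) p v * B p ν
        + g (Φ p) μ ν * A p μ * fderiv ℝ (fun q => B q ν) p v
        + ∑ ρ, ∑ l, g (Φ p) ν l * (christoffel g (Φ p) l ρ μ * vel Φ v p ρ * A p μ) * B p ν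
        + ∑ ρ, ∑ l, g (Φ p) μ l * A p μ
            * (christoffel g (Φ p) l ρ ν * vel Φ v p ρ * B p ν) := fun μ ν => by
    rw [fderiv_apply_mul ((dg μ ν).fun_mul (dA μ)) (dB ν), fderiv_apply_mul (dg μ ν) (dA μ),
      fderiv_comp_eq_sum_pder (F := fun x => g x μ ν)
        ((hg.smooth μ ν).differentiableAt_of_isOpen hg.isOpen (hΦV hp))
        (hΦ.differentiableAt hW hp)]
    simp only [hg.pder_eq_sum_christoffel (hΦV hp), add_mul, Finset.sum_add_distrib,
      Finset.sum_mul, vel]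
    have e1 : ∀ ρ l, g (Φ p) μ l * christoffel g (Φ p) l ρ ν * fderiv ℝ (fun q => Φ q ρ) p v
        * A p μ * B p ν = g (Φ p) μ l * A p μ * (christoffel g (Φ p) l ρ ν
          * fderiv ℝ (fun q => Φ q ρ) p v * B p ν) := fun _ _ => by ring
    have e2 : ∀ ρ l, g (Φ p) ν l * christoffel g (Φ p) l ρ μ * fderiv ℝ (fun q => Φ q ρ) p v
        * A p μ * B p ν = g (Φ p) ν l * (christoffel g (Φ p) l ρ μ
          * fderiv ℝ (fun q => Φ q ρ) p v * A p μ) * B p ν := fun _ _ => by ring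
    simp only [e1, e2]
    ring
  simp only [metForm_apply, covD]
  rw [fderiv_apply_sum fun μ _ => DifferentiableAt.fun_sum fun ν _ =>
    ((dg μ ν).fun_mul (dA μ)).fun_mul (dB ν)]
  simp_rw [fderiv_apply_sum fun ν _ => ((dg _ ν).fun_mul (dA _)).fun_mul (dB ν), hd]
  simp only [Finset.sum_add_distrib, mul_add, add_mul, Finset.mul_sum, Finset.sum_mul]
  have e1 : ∑ μ, ∑ ν, ∑ ρ, ∑ l, g (Φ p) ν l
        * (christoffel g (Φ p) l ρ μ * vel Φ v p ρ * A p μ) * B p ν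
      = ∑ μ, ∑ ν, ∑ l, ∑ σ, g (Φ p) μ ν
        * (christoffel g (Φ p) μ l σ * vel Φ v p l * A p σ) * B p ν := by
    rw [Finset.sum_comm]
    refine (Finset.sum_congr rfl fun ν _ => sum_comm_outer_inner _).trans ?_
    rw [Finset.sum_comm]
    refine Finset.sum_congr rfl fun μ _ => Finset.sum_congr rfl fun ν _ => ?_
    simp_rw [hg.symm _ (hΦV hp) ν μ]
  have e2 : ∑ μ, ∑ ν, ∑ ρ, ∑ l, g (Φ p) μ l * A p μ
        * (christoffel g (Φ p) l ρ ν * vel Φ v p ρ * B p ν)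
      = ∑ μ, ∑ ν, ∑ l, ∑ σ, g (Φ p) μ ν * A p μ
        * (christoffel g (Φ p) ν l σ * vel Φ v p l * B p σ) :=
    Finset.sum_congr rfl fun μ _ => sum_comm_outer_inner _
  rw [e1, e2]
  ring

theorem covD_vel_comm (hg : IsMetricOn g V) {Φ : E → Fin N → ℝ} (hW : IsOpen W)
    (hΦ : SmoothField Φ W) (hΦV : Set.MapsTo Φ W V) {p : E} (hp : p ∈ W) (v w : E) :
    covD g Φ (vel Φ w) v p = covD g Φ (vel Φ v) w p := by
  ext ν
  unfold covD
  congr 1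
  · exact fderiv_fderiv_comm hW (hΦ ν) hp v w
  · rw [Finset.sum_comm]
    refine Finset.sum_congr rfl fun σ _ => Finset.sum_congr rfl fun l _ => ?_
    rw [hg.christoffel_symm (hΦV hp)]
    ring

theorem covD_add {Φ A B : E → Fin N → ℝ} {p : E}
    (hA : ∀ μ, DifferentiableAt ℝ (fun q => A q μ) p)
    (hB : ∀ μ, DifferentiableAt ℝ (fun q => B q μ) p) (v : E) :
    covD g Φ (fun q => A q + B q) v p = covD g Φ A v p + covD g Φ B v p := by
  ext ν
  simp only [covD, Pi.add_apply, mul_add, Finset.sum_add_distrib]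
  rw [fderiv_apply_add (hA ν) (hB ν)]
  ring

theorem covD_smul {Φ A : E → Fin N → ℝ} {F : E → ℝ} {p : E} (hF : DifferentiableAt ℝ F p)
    (hA : ∀ μ, DifferentiableAt ℝ (fun q => A q μ) p) (v : E) :
    covD g Φ (fun q => F q • A q) v p = fderiv ℝ F p v • A p + F p • covD g Φ A v p := by
  ext ν
  simp only [covD, Pi.add_apply, Pi.smul_apply, smul_eq_mul]
  rw [fderiv_apply_mul hF (hA ν), mul_add, Finset.mul_sum]
  simp_rw [Finset.mul_sum]
  rw [add_assoc]
  congr 2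
  exact Finset.sum_congr rfl fun _ _ => Finset.sum_congr rfl fun _ _ => by ring

theorem covD_sum {ι : Type*} [Fintype ι] {Φ : E → Fin N → ℝ} {A : ι → E → Fin N → ℝ} {p : E}
    (hA : ∀ i μ, DifferentiableAt ℝ (fun q => A i q μ) p) (v : E) :
    covD g Φ (fun q => ∑ i, A i q) v p = ∑ i, covD g Φ (A i) v p := by
  ext ν
  simp only [covD, Finset.sum_apply, Finset.sum_add_distrib]
  rw [fderiv_apply_sum fun i _ => hA i ν]
  congr 1
  simp_rw [Finset.mul_sum]
  simp_rw [Finset.sum_comm (t := (Finset.univ : Finset ι))]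

/-- The connection matrix `ω_v = Γ^ν_{lσ} ∂_vΦ^l`. -/
def connMatrix (g : (Fin N → ℝ) → Fin N → Fin N → ℝ) (Φ : E → Fin N → ℝ) (v p : E)
    (ν σ : Fin N) : ℝ :=
  ∑ l, christoffel g (Φ p) ν l σ * vel Φ v p l

theorem covD_eq_connMatrix (Φ A : E → Fin N → ℝ) (v p : E) (ν : Fin N) :
    covD g Φ A v p ν
      = fderiv ℝ (fun q => A q ν) p v + ∑ σ, connMatrix g Φ v p ν σ * A p σ := by
  simp only [covD, connMatrix, Finset.sum_mul]
  rw [Finset.sum_comm]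

theorem fderiv_connMatrix_sub (hg : IsMetricOn g V) {Φ : E → Fin N → ℝ} (hW : IsOpen W)
    (hΦ : SmoothField Φ W) (hΦV : Set.MapsTo Φ W V) {p : E} (hp : p ∈ W) (v w : E)
    (ν σ : Fin N) :
    fderiv ℝ (fun q => connMatrix g Φ w q ν σ) p v
        - fderiv ℝ (fun q => connMatrix g Φ v q ν σ) p w
      = ∑ μ, ∑ β, (pder (fun z => christoffel g z ν σ β) μ (Φ p)
          - pder (fun z => christoffel g z ν σ μ) β (Φ p)) * vel Φ v p μ * vel Φ w p β := by
  have dΓ : ∀ l, DifferentiableAt ℝ (fun q => christoffel g (Φ q) ν l σ) p := fun l =>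
    ((hg.contDiffOn_christoffel ν l σ).comp_field hΦ hΦV).differentiableAt_of_isOpen hW hp
  have key : ∀ v w, fderiv ℝ (fun q => connMatrix g Φ w q ν σ) p v
      = ∑ l, ∑ ρ, pder (fun z => christoffel g z ν σ l) ρ (Φ p) * vel Φ v p ρ * vel Φ w p l
        + ∑ l, christoffel g (Φ p) ν l σ
          * fderiv ℝ (fun q => fderiv ℝ (fun r => Φ r l) q w) p v := fun v w => by
    have dv := (hΦ.vel hW w).differentiableAt hW hp
    unfold connMatrix
    rw [fderiv_apply_sum fun l _ => (dΓ l).fun_mul (dv l), ← Finset.sum_add_distrib]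
    refine Finset.sum_congr rfl fun l _ => ?_
    rw [fderiv_apply_mul (dΓ l) (dv l),
      fderiv_comp_eq_sum_pder (F := fun z => christoffel g z ν l σ)
        ((hg.contDiffOn_christoffel ν l σ).differentiableAt_of_isOpen hg.isOpen (hΦV hp))
        (hΦ.differentiableAt hW hp), Finset.sum_mul]
    simp_rw [hg.pder_christoffel_symm (hΦV hp) ν l σ]
    rfl
  rw [key v w, key w v]
  simp_rw [fderiv_fderiv_comm hW (hΦ _) hp v w]
  rw [add_sub_add_right_eq_sub, Finset.sum_comm]
  simp only [sub_mul, Finset.sum_sub_distrib]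
  congr 1
  exact Finset.sum_congr rfl fun _ _ => Finset.sum_congr rfl fun _ _ => by ring

theorem curvOp_eq_connMatrix (hg : IsMetricOn g V) {Φ : E → Fin N → ℝ} (hW : IsOpen W)
    (hΦ : SmoothField Φ W) (hΦV : Set.MapsTo Φ W V) {p : E} (hp : p ∈ W) (v w : E)
    (A : Fin N → ℝ) (ν : Fin N) :
    curvOp g (Φ p) (vel Φ w p) A (vel Φ v p) ν
      = ∑ σ, (fderiv ℝ (fun q => connMatrix g Φ w q ν σ) p v
          - fderiv ℝ (fun q => connMatrix g Φ v q ν σ) p w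
          + ∑ τ, (connMatrix g Φ v p ν τ * connMatrix g Φ w p τ σ
            - connMatrix g Φ w p ν τ * connMatrix g Φ v p τ σ)) * A σ := by
  have prod : ∀ v w σ, ∑ τ, connMatrix g Φ v p ν τ * connMatrix g Φ w p τ σ
      = ∑ μ, ∑ β, ∑ τ, christoffel g (Φ p) ν τ μ * christoffel g (Φ p) τ σ β
          * vel Φ v p μ * vel Φ w p β := fun v w σ => by
    simp only [connMatrix, Finset.sum_mul_sum]
    rw [Finset.sum_comm]
    refine Finset.sum_congr rfl fun μ _ => ?_
    rw [Finset.sum_comm]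
    refine Finset.sum_congr rfl fun β _ => Finset.sum_congr rfl fun τ _ => ?_
    rw [hg.christoffel_symm (hΦV hp) ν μ τ, hg.christoffel_symm (hΦV hp) τ β σ]
    ring
  rw [curvOp_apply]
  refine Finset.sum_congr rfl fun σ _ => ?_
  rw [fderiv_connMatrix_sub hg hW hΦ hΦV hp, Finset.sum_sub_distrib, prod v w, prod w v,
    Finset.sum_comm (s := Finset.univ) (t := Finset.univ)
      (f := fun μ β : Fin N => ∑ τ, christoffel g (Φ p) ν τ μ
      * christoffel g (Φ p) τ σ β * vel Φ w p μ * vel Φ v p β),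
    ← Finset.sum_sub_distrib, ← Finset.sum_add_distrib, Finset.sum_mul]
  refine Finset.sum_congr rfl fun μ _ => ?_
  rw [← Finset.sum_sub_distrib, ← Finset.sum_add_distrib, Finset.sum_mul]
  refine Finset.sum_congr rfl fun β _ => ?_
  rw [← Finset.sum_sub_distrib, riemann]
  simp only [add_mul, Finset.sum_mul]
  congr 1
  · ring
  · exact Finset.sum_congr rfl fun τ _ => by ring

theorem contDiffOn_connMatrix (hg : IsMetricOn g V) {Φ : E → Fin N → ℝ} (hW : IsOpen W)
    (hΦ : SmoothField Φ W) (hΦV : Set.MapsTo Φ W V) (v : E) (ν σ : Fin N) :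
    ContDiffOn ℝ (⊤ : ℕ∞) (fun q => connMatrix g Φ v q ν σ) W :=
  ContDiffOn.sum fun l _ =>
    ((hg.contDiffOn_christoffel ν l σ).comp_field hΦ hΦV).mul (hΦ.vel hW v l)

theorem covD_covD_sub (hg : IsMetricOn g V) {Φ A : E → Fin N → ℝ} (hW : IsOpen W)
    (hΦ : SmoothField Φ W) (hΦV : Set.MapsTo Φ W V) (hA : SmoothField A W)
    {p : E} (hp : p ∈ W) (v w : E) :
    covD g Φ (covD g Φ A w) v p - covD g Φ (covD g Φ A v) w p
      = curvOp g (Φ p) (vel Φ w p) (A p) (vel Φ v p) := by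
  ext ν
  have dA := hA.differentiableAt hW hp
  have dω : ∀ v ν σ, DifferentiableAt ℝ (fun q => connMatrix g Φ v q ν σ) p := fun v ν σ =>
    (contDiffOn_connMatrix hg hW hΦ hΦV v ν σ).differentiableAt_of_isOpen hW hp
  have ddA : ∀ v ν, DifferentiableAt ℝ (fun q => fderiv ℝ (fun r => A r ν) q v) p :=
    fun v ν => (hA.vel hW v).differentiableAt hW hp ν
  have key : ∀ v w, covD g Φ (covD g Φ A w) v p ν
      = fderiv ℝ (fun q => fderiv ℝ (fun r => A r ν) q w) p v
        + (∑ σ, fderiv ℝ (fun q => connMatrix g Φ w q ν σ) p v * A p σ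
          + ∑ σ, connMatrix g Φ w p ν σ * fderiv ℝ (fun q => A q σ) p v)
        + (∑ σ, connMatrix g Φ v p ν σ * fderiv ℝ (fun q => A q σ) p w
          + ∑ σ, (∑ τ, connMatrix g Φ v p ν τ * connMatrix g Φ w p τ σ) * A p σ) :=
    fun v w => by
    rw [covD_eq_connMatrix]
    simp only [covD_eq_connMatrix]
    rw [fderiv_apply_add (ddA w ν)
        (DifferentiableAt.fun_sum fun σ _ => (dω w ν σ).fun_mul (dA σ)),
      fderiv_apply_sum fun σ _ => (dω w ν σ).fun_mul (dA σ)]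
    simp_rw [fderiv_apply_mul (dω w ν _) (dA _), mul_add, Finset.sum_add_distrib,
      Finset.mul_sum, Finset.sum_mul]
    congr 2
    rw [Finset.sum_comm]
    exact Finset.sum_congr rfl fun _ _ => Finset.sum_congr rfl fun _ _ => by ring
  rw [Pi.sub_apply, key v w, key w v, curvOp_eq_connMatrix hg hW hΦ hΦV hp,
    fderiv_fderiv_comm hW (hA ν) hp v w]
  simp only [add_mul, sub_mul, Finset.sum_add_distrib, Finset.sum_sub_distrib]
  ring

theorem metForm_curvOp_vel_antisymm (hg : IsMetricOn g V) {Φ A B : E → Fin N → ℝ}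
    (hW : IsOpen W) (hΦ : SmoothField Φ W) (hΦV : Set.MapsTo Φ W V) (hA : SmoothField A W)
    (hB : SmoothField B W) {p : E} (hp : p ∈ W) (v w : E) :
    metForm g (Φ p) (A p) (curvOp g (Φ p) (vel Φ w p) (B p) (vel Φ v p))
      = -metForm g (Φ p) (B p) (curvOp g (Φ p) (vel Φ w p) (A p) (vel Φ v p)) := by
  have key : ∀ v w, fderiv ℝ
      (fun q => fderiv ℝ (fun r => metForm g (Φ r) (A r) (B r)) q w) p v
      = (metForm g (Φ p) (covD g Φ (covD g Φ A w) v p) (B p)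
          + metForm g (Φ p) (covD g Φ A w p) (covD g Φ B v p))
        + (metForm g (Φ p) (covD g Φ A v p) (covD g Φ B w p)
          + metForm g (Φ p) (A p) (covD g Φ (covD g Φ B w) v p)) := fun v w => by
    have cA := smoothField_covD hg hW hΦ hΦV hA w
    have cB := smoothField_covD hg hW hΦ hΦV hB w
    rw [fderiv_eq_of_eqOn hW (fun q hq => fderiv_metForm hg hW hΦ hΦV hA hB hq w) hp,
      fderiv_apply_add
        ((contDiffOn_metForm hg hΦ hΦV cA hB).differentiableAt_of_isOpen hW hp)
        ((contDiffOn_metForm hg hΦ hΦV hA cB).differentiableAt_of_isOpen hW hp),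
      fderiv_metForm hg hW hΦ hΦV cA hB hp, fderiv_metForm hg hW hΦ hΦV hA cB hp]
  have h := fderiv_fderiv_comm hW (contDiffOn_metForm hg hΦ hΦV hA hB) hp v w
  rw [key v w, key w v] at h
  rw [← covD_covD_sub hg hW hΦ hΦV hA hp, ← covD_covD_sub hg hW hΦ hΦV hB hp, map_sub, map_sub,
    hg.metForm_comm (hΦV hp) (B p), hg.metForm_comm (hΦV hp) (B p)]
  linarith

theorem IsMetricOn.metForm_curvOp_antisymm (hg : IsMetricOn g V) {x : Fin N → ℝ}
    (hx : x ∈ V) (A B X Y : Fin N → ℝ) :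
    metForm g x A (curvOp g x Y B X) = -metForm g x B (curvOp g x Y A X) := by
  have hv : ∀ v, vel (fun q : Fin N → ℝ => q) v x = v := fun v => by
    ext μ
    simp only [vel]
    rw [(hasFDerivAt_apply (𝕜 := ℝ) μ x).fderiv]
    rfl
  have h := metForm_curvOp_vel_antisymm hg (Φ := fun q => q) (A := fun _ => A)
    (B := fun _ => B) hg.isOpen (fun μ => contDiffOn_pi.1 contDiffOn_id μ) (fun _ h => h)
    (fun _ => contDiffOn_const) (fun _ => contDiffOn_const) hx X Y
  simpa only [hv] using h

end CovariantDerivative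

section Hypersurface

variable {m : ℕ} {g : (Fin (m + 1) → ℝ) → Fin (m + 1) → Fin (m + 1) → ℝ}
  {V : Set (Fin (m + 1) → ℝ)}

/-- Expansion of the inner product with a vector `Z` orthogonal to `ν` in a frame `e` spanning the
orthogonal complement of `ν`. -/
theorem IsMetricOn.metForm_eq_sum_frame (hg : IsMetricOn g V) {x : Fin (m + 1) → ℝ} (hx : x ∈ V)
    {e : Fin m → Fin (m + 1) → ℝ} {ν : Fin (m + 1) → ℝ} (hν : metForm g x ν ν ≠ 0)
    (hνe : ∀ a, metForm g x ν (e a) = 0) {H : Matrix (Fin m) (Fin m) ℝ}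
    (hH : ∀ a b, H a b = metForm g x (e a) (e b)) (hdet : IsUnit H.det)
    {Z : Fin (m + 1) → ℝ} (hZ : metForm g x Z ν = 0) (Z' : Fin (m + 1) → ℝ) :
    metForm g x Z Z'
      = ∑ c, ∑ d, metForm g x (e c) Z * H⁻¹ c d * metForm g x (e d) Z' := by
  have hli : LinearIndependent ℝ (Fin.cons ν e : Fin (m + 1) → Fin (m + 1) → ℝ) := by
    rw [linearIndependent_finCons]
    refine ⟨Fintype.linearIndependent_iff.2 fun v hv => ?_, fun hmem => hν ?_⟩
    · refine congrFun (Matrix.eq_zero_of_mulVec_eq_zero hdet.ne_zero (v := v) ?_)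
      ext a
      have := congrArg (metForm g x (e a)) hv
      simp only [map_sum, map_smul, smul_eq_mul, map_zero, ← hH] at this
      simpa [Matrix.mulVec, dotProduct, mul_comm] using this
    · have hle : Submodule.span ℝ (Set.range e) ≤ LinearMap.ker (metForm g x ν) :=
        Submodule.span_le.2 (by rintro _ ⟨a, rfl⟩; exact hνe a)
      exact hle hmem
  have hspan := hli.span_eq_top_of_card_eq_finrank' (by simp)
  set k : Fin m → ℝ := fun d => ∑ c, metForm g x (e c) Z * H⁻¹ c d with hk
  have hke : ∀ b, ∑ d, k d * H d b = metForm g x Z (e b) := fun b => by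
    have h1 : ∀ c, ∑ d, H⁻¹ c d * H d b = if c = b then 1 else 0 := fun c => by
      rw [← Matrix.mul_apply, Matrix.nonsing_inv_mul _ hdet, Matrix.one_apply]
    simp only [hk, Finset.sum_mul]
    rw [Finset.sum_comm]
    simp only [mul_assoc, ← Finset.mul_sum, h1]
    simp [hg.metForm_comm hx (e b) Z]
  have hY : Z - ∑ d, k d • e d = 0 := by
    refine hg.eq_zero_of_metForm hx fun B => ?_
    have hB : B ∈ Submodule.span ℝ (Set.range (Fin.cons ν e : Fin (m + 1) → _)) :=
      hspan ▸ Submodule.mem_top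
    induction hB using Submodule.span_induction with
    | mem y hy =>
      obtain ⟨a, rfl⟩ := hy
      refine Fin.cases ?_ (fun b => ?_) a
      · simp [hZ, hg.metForm_comm hx (e _) ν, hνe]
      · simp [← hH, hke]
    | zero => simp
    | add y z _ _ hy hz => rw [map_add, hy, hz, add_zero]
    | smul c y _ hy => rw [map_smul, hy, smul_zero]
  conv_lhs => rw [sub_eq_zero.1 hY]
  rw [Finset.sum_comm]
  simp [hk, Finset.sum_mul]

variable {E : Type*} [NormedAddCommGroup E] [NormedSpace ℝ E] {W : Set E}

/-- The second fundamental form of the frame `∂_aΦ` with respect to the normal field `ν`. -/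
def sndForm (g : (Fin (m + 1) → ℝ) → Fin (m + 1) → Fin (m + 1) → ℝ)
    (Φ ν : E → Fin (m + 1) → ℝ) (e : Fin m → E) (q : E) (a b : Fin m) : ℝ :=
  metForm g (Φ q) (vel Φ (e a) q) (covD g Φ ν (e b) q)

/-- A smooth map with a smooth unit normal field `ν` to its partial derivatives in the
directions `e`. -/
structure IsNormalFamily (g : (Fin (m + 1) → ℝ) → Fin (m + 1) → Fin (m + 1) → ℝ)
    (V : Set (Fin (m + 1) → ℝ)) (W : Set E) (Φ ν : E → Fin (m + 1) → ℝ) (e : Fin m → E)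
    (ϵ : ℝ) : Prop where
  metric : IsMetricOn g V
  isOpen : IsOpen W
  smooth : SmoothField Φ W
  mapsTo : Set.MapsTo Φ W V
  smooth_normal : SmoothField ν W
  orth : ∀ q ∈ W, ∀ a, metForm g (Φ q) (ν q) (vel Φ (e a) q) = 0
  unit : ∀ q ∈ W, metForm g (Φ q) (ν q) (ν q) = ϵ

namespace IsNormalFamily

variable {Φ ν : E → Fin (m + 1) → ℝ} {e : Fin m → E} {ϵ : ℝ}

theorem smooth_covD (h : IsNormalFamily g V W Φ ν e ϵ) {A : E → Fin (m + 1) → ℝ}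
    (hA : SmoothField A W) (v : E) : SmoothField (covD g Φ A v) W :=
  smoothField_covD h.metric h.isOpen h.smooth h.mapsTo hA v

theorem contDiffOn_sndForm (h : IsNormalFamily g V W Φ ν e ϵ) (a b : Fin m) :
    ContDiffOn ℝ (⊤ : ℕ∞) (fun q => sndForm g Φ ν e q a b) W :=
  contDiffOn_metForm h.metric h.smooth h.mapsTo (h.smooth.vel h.isOpen _)
    (h.smooth_covD h.smooth_normal _)

theorem fderiv_metForm (h : IsNormalFamily g V W Φ ν e ϵ) {A B : E → Fin (m + 1) → ℝ}
    (hA : SmoothField A W) (hB : SmoothField B W) {p : E} (hp : p ∈ W) (v : E) :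
    fderiv ℝ (fun q => metForm g (Φ q) (A q) (B q)) p v
      = metForm g (Φ p) (covD g Φ A v p) (B p) + metForm g (Φ p) (A p) (covD g Φ B v p) :=
  _root_.fderiv_metForm h.metric h.isOpen h.smooth h.mapsTo hA hB hp v

theorem metForm_normal_covD (h : IsNormalFamily g V W Φ ν e ϵ) {q : E} (hq : q ∈ W) (v : E) :
    metForm g (Φ q) (covD g Φ ν v q) (ν q) = 0 := by
  have h1 := h.fderiv_metForm h.smooth_normal h.smooth_normal hq v
  rw [fderiv_eq_of_eqOn h.isOpen h.unit hq, h.metric.metForm_comm (h.mapsTo hq) (ν q)] at h1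
  simp at h1
  linarith

theorem metForm_vel_covD_normal (h : IsNormalFamily g V W Φ ν e ϵ) {q : E} (hq : q ∈ W)
    (v : E) (a : Fin m) : metForm g (Φ q) (vel Φ (e a) q) (covD g Φ ν v q)
      = -metForm g (Φ q) (covD g Φ (vel Φ (e a)) v q) (ν q) := by
  have h1 := h.fderiv_metForm h.smooth_normal (h.smooth.vel h.isOpen (e a)) hq v
  rw [fderiv_eq_of_eqOn h.isOpen (fun r hr => h.orth r hr a) hq,
    h.metric.metForm_comm (h.mapsTo hq) (ν q),
    h.metric.metForm_comm (h.mapsTo hq) (covD g Φ ν v q)] at h1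
  simp at h1
  linarith

theorem sndForm_comm (h : IsNormalFamily g V W Φ ν e ϵ) {q : E} (hq : q ∈ W) (a b : Fin m) :
    sndForm g Φ ν e q a b = sndForm g Φ ν e q b a := by
  unfold sndForm
  rw [h.metForm_vel_covD_normal hq, h.metForm_vel_covD_normal hq,
    covD_vel_comm h.metric h.isOpen h.smooth h.mapsTo hq]

theorem fderiv_sndForm (h : IsNormalFamily g V W Φ ν e ϵ) {p : E} (hp : p ∈ W) (v : E)
    (a b : Fin m) : fderiv ℝ (fun q => sndForm g Φ ν e q a b) p v
      = metForm g (Φ p) (covD g Φ (vel Φ (e a)) v p) (covD g Φ ν (e b) p)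
        + metForm g (Φ p) (vel Φ (e a) p) (covD g Φ (covD g Φ ν (e b)) v p) :=
  h.fderiv_metForm (h.smooth.vel h.isOpen _) (h.smooth_covD h.smooth_normal _) hp v

theorem metForm_vel_curvOp (h : IsNormalFamily g V W Φ ν e ϵ) {p : E} (hp : p ∈ W)
    (a b c : Fin m) :
    metForm g (Φ p) (vel Φ (e a) p)
        (curvOp g (Φ p) (vel Φ (e b) p) (ν p) (vel Φ (e c) p))
      = fderiv ℝ (fun q => sndForm g Φ ν e q a b) p (e c)
        - fderiv ℝ (fun q => sndForm g Φ ν e q c a) p (e b)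
        - metForm g (Φ p) (covD g Φ (vel Φ (e c)) (e a) p) (covD g Φ ν (e b) p)
        + metForm g (Φ p) (covD g Φ ν (e c) p) (covD g Φ (vel Φ (e a)) (e b) p) := by
  rw [fderiv_eq_of_eqOn h.isOpen (fun q hq => h.sndForm_comm hq c a) hp,
    h.fderiv_sndForm hp, h.fderiv_sndForm hp,
    ← covD_covD_sub h.metric h.isOpen h.smooth h.mapsTo h.smooth_normal hp, map_sub,
    covD_vel_comm h.metric h.isOpen h.smooth h.mapsTo hp (e c) (e a),
    h.metric.metForm_comm (h.mapsTo hp) (covD g Φ ν (e c) p)]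
  ring

/-- First variation of the second fundamental form in a direction `τ` along which the velocity
decomposes as `F ν + X^c ∂_cΦ` on a slice `S` tangent to the directions `e`. -/
theorem fderiv_sndForm_of_decomposition (h : IsNormalFamily g V W Φ ν e ϵ) (hϵ : ϵ ≠ 0)
    {S : Set E} (hSW : S ⊆ W)
    (hS : ∀ F G : E → ℝ, Set.EqOn F G S → ∀ p ∈ S, DifferentiableAt ℝ F p →
      DifferentiableAt ℝ G p → ∀ a, fderiv ℝ F p (e a) = fderiv ℝ G p (e a))
    {τ : E} {F : E → ℝ} {X : Fin m → E → ℝ} (hF : ContDiffOn ℝ (⊤ : ℕ∞) F W)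
    (hX : ∀ c, ContDiffOn ℝ (⊤ : ℕ∞) (X c) W)
    (hdec : ∀ q ∈ S, vel Φ τ q = F q • ν q + ∑ c, X c q • vel Φ (e c) q)
    {p : E} (hp : p ∈ S) {H : Matrix (Fin m) (Fin m) ℝ}
    (hH : ∀ a b, H a b = metForm g (Φ p) (vel Φ (e a) p) (vel Φ (e b) p))
    (hdet : IsUnit H.det) (a b : Fin m) :
    fderiv ℝ (fun q => sndForm g Φ ν e q a b) p τ
      = F p * (∑ i, ∑ j, sndForm g Φ ν e p a i * H⁻¹ i j * sndForm g Φ ν e p j b)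
        - F p * metForm g (Φ p) (ν p)
            (curvOp g (Φ p) (vel Φ (e b) p) (vel Φ (e a) p) (ν p))
        - ϵ * (fderiv ℝ (fun q => fderiv ℝ F q (e b)) p (e a)
            - ∑ c, (∑ d, H⁻¹ c d * metForm g (Φ p) (vel Φ (e d) p)
                (covD g Φ (vel Φ (e a)) (e b) p)) * fderiv ℝ F p (e c))
        + ∑ c, (X c p * fderiv ℝ (fun q => sndForm g Φ ν e q a b) p (e c)
            + sndForm g Φ ν e p c b * fderiv ℝ (X c) p (e a)
            + sndForm g Φ ν e p a c * fderiv ℝ (X c) p (e b)) := by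
  have hpW := hSW hp
  have sE : ∀ c, SmoothField (vel Φ (e c)) W := fun c => h.smooth.vel h.isOpen (e c)
  have sT : SmoothField (vel Φ τ) W := h.smooth.vel h.isOpen τ
  have dF : ∀ q ∈ W, DifferentiableAt ℝ F q := fun q hq => hF.differentiableAt_of_isOpen h.isOpen hq
  have dX : ∀ c, ∀ q ∈ W, DifferentiableAt ℝ (X c) q := fun c q hq =>
    (hX c).differentiableAt_of_isOpen h.isOpen hq
  have dK : ∀ a b, DifferentiableAt ℝ (fun q => sndForm g Φ ν e q a b) p := fun a b =>
    (h.contDiffOn_sndForm a b).differentiableAt_of_isOpen h.isOpen hpW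
  have dD : DifferentiableAt ℝ (fun q => fderiv ℝ F q (e a)) p :=
    (hF.fderiv_apply_const h.isOpen _).differentiableAt_of_isOpen h.isOpen hpW
  have hE_normal : ∀ q ∈ W, ∀ v, metForm g (Φ q) (ν q) (covD g Φ ν v q) = 0 := fun q hq v => by
    rw [h.metric.metForm_comm (h.mapsTo hq), h.metForm_normal_covD hq]
  have hDτ : ∀ q ∈ S, ∀ c, metForm g (Φ q) (vel Φ (e c) q) (covD g Φ ν τ q)
      = -ϵ * fderiv ℝ F q (e c) + ∑ d, X d q * sndForm g Φ ν e q d c := fun q hq c => by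
    have hqW := hSW hq
    have hTν : Set.EqOn (fun r => metForm g (Φ r) (vel Φ τ r) (ν r)) (fun r => ϵ * F r) S :=
      fun r hr => by
        have ho : ∀ d, metForm g (Φ r) (vel Φ (e d) r) (ν r) = 0 := fun d => by
          rw [h.metric.metForm_comm (h.mapsTo (hSW hr)), h.orth r (hSW hr)]
        simp [hdec r hr, ho, h.unit r (hSW hr), mul_comm]
    have h1 := h.fderiv_metForm sT h.smooth_normal hqW (e c)
    rw [hS _ _ hTν q hq ((contDiffOn_metForm h.metric h.smooth h.mapsTo sT
        h.smooth_normal).differentiableAt_of_isOpen h.isOpen hqW)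
        ((dF q hqW).const_mul ϵ), fderiv_const_mul (dF q hqW),
      ← covD_vel_comm h.metric h.isOpen h.smooth h.mapsTo hqW, hdec q hq] at h1
    rw [h.metForm_vel_covD_normal hqW]
    simp [hE_normal q hqW] at h1
    simp only [sndForm]
    linarith
  have hDbDτ : metForm g (Φ p) (vel Φ (e a) p) (covD g Φ (covD g Φ ν τ) (e b) p)
      = -ϵ * fderiv ℝ (fun q => fderiv ℝ F q (e b)) p (e a)
        + ∑ c, (fderiv ℝ (X c) p (e b) * sndForm g Φ ν e p c a
          + X c p * fderiv ℝ (fun q => sndForm g Φ ν e q c a) p (e b))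
        - metForm g (Φ p) (covD g Φ (vel Φ (e a)) (e b) p) (covD g Φ ν τ p) := by
    have sDν := h.smooth_covD h.smooth_normal τ
    have h1 := h.fderiv_metForm (sE a) sDν hpW (e b)
    have dsum : DifferentiableAt ℝ (fun q => ∑ d, X d q * sndForm g Φ ν e q d a) p :=
      DifferentiableAt.fun_sum fun d _ => (dX d p hpW).fun_mul (dK d a)
    rw [hS _ _ (fun q hq => hDτ q hq a) p hp ((contDiffOn_metForm h.metric h.smooth h.mapsTo
        (sE a) sDν).differentiableAt_of_isOpen h.isOpen hpW)
        ((dD.const_mul (-ϵ)).fun_add dsum),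
      fderiv_apply_add (dD.const_mul (-ϵ)) dsum, fderiv_const_mul dD,
      fderiv_apply_sum fun d _ => (dX d p hpW).fun_mul (dK d a)] at h1
    simp_rw [fderiv_apply_mul (dX _ p hpW) (dK _ a)] at h1
    rw [fderiv_fderiv_comm h.isOpen hF hpW (e a) (e b)]
    simp only [smul_apply, smul_eq_mul] at h1
    linarith
  have hDT : covD g Φ (vel Φ τ) (e a) p = fderiv ℝ F p (e a) • ν p
      + F p • covD g Φ ν (e a) p + ∑ c, (fderiv ℝ (X c) p (e a) • vel Φ (e c) p
        + X c p • covD g Φ (vel Φ (e c)) (e a) p) := by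
    have dN := h.smooth_normal.differentiableAt h.isOpen hpW
    have dE := fun c => (sE c).differentiableAt h.isOpen hpW
    have dXE : ∀ c μ, DifferentiableAt ℝ (fun q => (X c q • vel Φ (e c) q) μ) p :=
      fun c μ => (dX c p hpW).fun_mul (dE c μ)
    have dFN : ∀ μ, DifferentiableAt ℝ (fun q => (F q • ν q) μ) p :=
      fun μ => (dF p hpW).fun_mul (dN μ)
    have dsum : ∀ μ, DifferentiableAt ℝ (fun q => (∑ c, X c q • vel Φ (e c) q) μ) p :=
      fun μ => by
        simp only [Finset.sum_apply]
        exact DifferentiableAt.fun_sum fun c _ => dXE c μ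
    have h1 : covD g Φ (vel Φ τ) (e a) p
        = covD g Φ (fun q => F q • ν q + ∑ c, X c q • vel Φ (e c) q) (e a) p := by
      ext μ
      simp only [covD]
      rw [hdec p hp, hS _ _ (fun q hq => congrFun (hdec q hq) μ) p hp
        (sT.differentiableAt h.isOpen hpW μ) ((dFN μ).fun_add (dsum μ))]
    rw [h1, covD_add dFN dsum, covD_smul (dF p hpW) dN, covD_sum dXE]
    simp_rw [covD_smul (dX _ p hpW) (dE _)]
  have hframe : ∀ v Z', metForm g (Φ p) (covD g Φ ν v p) Z'
      = ∑ c, ∑ d, metForm g (Φ p) (vel Φ (e c) p) (covD g Φ ν v p) * H⁻¹ c d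
          * metForm g (Φ p) (vel Φ (e d) p) Z' := fun v Z' =>
    h.metric.metForm_eq_sum_frame (h.mapsTo hpW) (by rwa [h.unit p hpW]) (h.orth p hpW) hH hdet
      (h.metForm_normal_covD hpW v) Z'
  set Γ : Fin m → ℝ := fun c => ∑ d, H⁻¹ c d * metForm g (Φ p) (vel Φ (e d) p)
    (covD g Φ (vel Φ (e a)) (e b) p) with hΓ
  have hframeΓ : ∀ v, metForm g (Φ p) (covD g Φ ν v p) (covD g Φ (vel Φ (e a)) (e b) p)
      = ∑ c, metForm g (Φ p) (vel Φ (e c) p) (covD g Φ ν v p) * Γ c := fun v => by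
    rw [hframe]
    simp only [hΓ, Finset.mul_sum, mul_assoc]
  have hK2 : metForm g (Φ p) (covD g Φ ν (e a) p) (covD g Φ ν (e b) p)
      = ∑ i, ∑ j, sndForm g Φ ν e p a i * H⁻¹ i j * sndForm g Φ ν e p j b := by
    rw [hframe]
    simp_rw [h.sndForm_comm hpW a]
    rfl
  have hτΓ : metForm g (Φ p) (covD g Φ (vel Φ (e a)) (e b) p) (covD g Φ ν τ p)
      = -ϵ * ∑ c, Γ c * fderiv ℝ F p (e c)
        + ∑ c, X c p * metForm g (Φ p) (covD g Φ ν (e c) p)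
          (covD g Φ (vel Φ (e a)) (e b) p) := by
    rw [h.metric.metForm_comm (h.mapsTo hpW), hframeΓ]
    simp_rw [hframeΓ, hDτ p hp, add_mul, Finset.sum_add_distrib, Finset.mul_sum, Finset.sum_mul]
    congr 1
    · exact Finset.sum_congr rfl fun _ _ => by ring
    · rw [Finset.sum_comm]
      refine Finset.sum_congr rfl fun c _ => Finset.sum_congr rfl fun d _ => ?_
      rw [h.sndForm_comm hpW c d, sndForm]
      ring
  have hcurv : metForm g (Φ p) (vel Φ (e a) p)
      (curvOp g (Φ p) (vel Φ (e b) p) (ν p) (vel Φ τ p))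
      = -(F p * metForm g (Φ p) (ν p)
            (curvOp g (Φ p) (vel Φ (e b) p) (vel Φ (e a) p) (ν p)))
        + ∑ c, X c p * metForm g (Φ p) (vel Φ (e a) p)
          (curvOp g (Φ p) (vel Φ (e b) p) (ν p) (vel Φ (e c) p)) := by
    rw [hdec p hp]
    simp only [map_add, map_smul, map_sum, smul_eq_mul]
    rw [h.metric.metForm_curvOp_antisymm (h.mapsTo hpW)]
    ring
  have hcomm : metForm g (Φ p) (vel Φ (e a) p) (covD g Φ (covD g Φ ν (e b)) τ p)
      = metForm g (Φ p) (vel Φ (e a) p) (covD g Φ (covD g Φ ν τ) (e b) p)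
        + metForm g (Φ p) (vel Φ (e a) p)
          (curvOp g (Φ p) (vel Φ (e b) p) (ν p) (vel Φ τ p)) := by
    rw [← covD_covD_sub h.metric h.isOpen h.smooth h.mapsTo h.smooth_normal hpW, map_sub]
    ring
  rw [h.fderiv_sndForm hpW, hcomm, hcurv, hDbDτ, hτΓ,
    covD_vel_comm h.metric h.isOpen h.smooth h.mapsTo hpW τ (e a), hDT, ← hK2]
  simp_rw [h.metForm_vel_curvOp hpW]
  simp only [map_add, map_smul, map_sum, LinearMap.add_apply, LinearMap.smul_apply,
    LinearMap.sum_apply, smul_eq_mul, hE_normal p hpW, mul_zero, zero_add, mul_add, mul_sub,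
    Finset.sum_add_distrib, Finset.sum_sub_distrib]
  simp_rw [h.sndForm_comm hpW a, mul_comm (sndForm g Φ ν e p _ _) (fderiv ℝ (X _) p _)]
  simp only [sndForm]
  ring

end IsNormalFamily

end Hypersurface

section Slice

variable {n : ℕ}

theorem pder_eq_fderiv_prod {F : ℝ × (Fin n → ℝ) → ℝ} {t : ℝ} {y : Fin n → ℝ}
    (hF : DifferentiableAt ℝ F (t, y)) (a : Fin n) :
    pder (fun z => F (t, z)) a y = fderiv ℝ F (t, y) (0, Pi.single a 1) := by
  have h := hF.hasFDerivAt.comp y (hasFDerivAt_prodMk_right t y)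
  rw [pder, show (fun z => F (t, z)) = F ∘ fun z => (t, z) from rfl, h.fderiv]
  simp

theorem deriv_eq_fderiv_prod {F : ℝ × (Fin n → ℝ) → ℝ} {t : ℝ} {y : Fin n → ℝ}
    (hF : DifferentiableAt ℝ F (t, y)) :
    deriv (fun s => F (s, y)) t = fderiv ℝ F (t, y) (1, 0) := by
  have h := hF.hasFDerivAt.comp_hasDerivAt t
    ((hasFDerivAt_prodMk_left t y).comp_hasDerivAt t (hasDerivAt_id t))
  rw [show (fun s => F (s, y)) = F ∘ ((fun s => (s, y)) ∘ id) from rfl, h.deriv]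
  simp

theorem pder_eq_of_eqOn {F G : (Fin n → ℝ) → ℝ} {U : Set (Fin n → ℝ)} (hU : IsOpen U)
    (h : Set.EqOn F G U) {y : Fin n → ℝ} (hy : y ∈ U) (a : Fin n) :
    pder F a y = pder G a y := by
  rw [pder, fderiv_eq_of_eqOn hU h hy, pder]

end Slice

section Variation

variable {n : ℕ} {g : (Fin (n + 1) → ℝ) → Fin (n + 1) → Fin (n + 1) → ℝ}
  {V : Set (Fin (n + 1) → ℝ)} {φ nrm : ℝ → (Fin n → ℝ) → Fin (n + 1) → ℝ} {I : Set ℝ}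
  {U : Set (Fin n → ℝ)} {ϵ : ℝ}

/-- The coordinate direction `∂_a` in space-time. -/
def spaceDir {n : ℕ} (a : Fin n) : ℝ × (Fin n → ℝ) := (0, Pi.single a 1)

theorem Dphi_eq_vel (hI : IsOpen I) (hU : IsOpen U)
    (hφ : SmoothField (fun q : ℝ × (Fin n → ℝ) => φ q.1 q.2) (I ×ˢ U))
    {t : ℝ} (ht : t ∈ I) {y : Fin n → ℝ} (hy : y ∈ U) (a : Fin n) (μ : Fin (n + 1)) :
    Dphi φ t y a μ = vel (fun q : ℝ × (Fin n → ℝ) => φ q.1 q.2) (spaceDir a) (t, y) μ :=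
  pder_eq_fderiv_prod (F := fun q => φ q.1 q.2 μ)
    (hφ.differentiableAt (hI.prod hU) ⟨ht, hy⟩ μ) a

theorem indMet_eq_metForm (hI : IsOpen I) (hU : IsOpen U)
    (hφ : SmoothField (fun q : ℝ × (Fin n → ℝ) => φ q.1 q.2) (I ×ˢ U))
    {t : ℝ} (ht : t ∈ I) {y : Fin n → ℝ} (hy : y ∈ U) (a b : Fin n) :
    indMet g φ t y a b = metForm g (φ t y)
      (vel (fun q : ℝ × (Fin n → ℝ) => φ q.1 q.2) (spaceDir a) (t, y))
      (vel (fun q : ℝ × (Fin n → ℝ) => φ q.1 q.2) (spaceDir b) (t, y)) := by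
  simp only [indMet, Dphi_eq_vel hI hU hφ ht hy, metForm_apply]

theorem extK_eq_sndForm (hI : IsOpen I) (hU : IsOpen U)
    (hφ : SmoothField (fun q : ℝ × (Fin n → ℝ) => φ q.1 q.2) (I ×ˢ U))
    (hn : SmoothField (fun q : ℝ × (Fin n → ℝ) => nrm q.1 q.2) (I ×ˢ U))
    {t : ℝ} (ht : t ∈ I) {y : Fin n → ℝ} (hy : y ∈ U) (a b : Fin n) :
    extK g φ nrm t y a b = sndForm g (fun q : ℝ × (Fin n → ℝ) => φ q.1 q.2)
      (fun q : ℝ × (Fin n → ℝ) => nrm q.1 q.2) spaceDir (t, y) a b := by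
  have h : ∀ ν, pder (fun z => nrm t z ν) b y
      = fderiv ℝ (fun q : ℝ × (Fin n → ℝ) => nrm q.1 q.2 ν) (t, y) (spaceDir b) := fun ν =>
    pder_eq_fderiv_prod (F := fun q => nrm q.1 q.2 ν)
      (hn.differentiableAt (hI.prod hU) ⟨ht, hy⟩ ν) b
  simp only [extK, Dphi_eq_vel hI hU hφ ht hy, sndForm, metForm_apply, covD, h]

theorem christoffelInd_eq_sum (h : IsNormalFamily g V (I ×ˢ U)
      (fun q : ℝ × (Fin n → ℝ) => φ q.1 q.2) (fun q => nrm q.1 q.2) spaceDir ϵ)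
    (hI : IsOpen I) (hU : IsOpen U) (h0 : (0 : ℝ) ∈ I) {y : Fin n → ℝ} (hy : y ∈ U)
    (c a b : Fin n) :
    christoffelInd g φ y c a b = ∑ d, indMetInv g φ 0 y c d
      * metForm g (φ 0 y)
        (vel (fun q : ℝ × (Fin n → ℝ) => φ q.1 q.2) (spaceDir d) (0, y))
        (covD g (fun q : ℝ × (Fin n → ℝ) => φ q.1 q.2)
          (vel (fun q : ℝ × (Fin n → ℝ) => φ q.1 q.2) (spaceDir a)) (spaceDir b) (0, y)) := by
  have hp : ((0 : ℝ), y) ∈ I ×ˢ U := ⟨h0, hy⟩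
  set Φ : ℝ × (Fin n → ℝ) → Fin (n + 1) → ℝ := fun q => φ q.1 q.2 with hΦ
  have sE : ∀ d : Fin n, SmoothField (vel Φ (spaceDir d)) (I ×ˢ U) :=
    fun d => h.smooth.vel h.isOpen _
  have hder : ∀ d b a, pder (fun z => indMet g φ 0 z d b) a y
      = metForm g (φ 0 y) (vel Φ (spaceDir b) (0, y))
          (covD g Φ (vel Φ (spaceDir d)) (spaceDir a) (0, y))
        + metForm g (φ 0 y) (vel Φ (spaceDir d) (0, y))
          (covD g Φ (vel Φ (spaceDir b)) (spaceDir a) (0, y)) := fun d b a => by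
    rw [pder_eq_of_eqOn hU (fun z hz => indMet_eq_metForm hI hU h.smooth h0 hz d b) hy,
      h.metric.metForm_comm (h.mapsTo hp) (vel Φ (spaceDir b) (0, y))]
    refine Eq.trans ?_ (h.fderiv_metForm (sE d) (sE b) hp (spaceDir a))
    exact pder_eq_fderiv_prod
      (F := fun q => metForm g (Φ q) (vel Φ (spaceDir d) q) (vel Φ (spaceDir b) q))
      ((contDiffOn_metForm h.metric h.smooth h.mapsTo (sE d) (sE b)).differentiableAt_of_isOpen
        h.isOpen hp) a
  rw [christoffelInd, Finset.mul_sum]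
  refine Finset.sum_congr rfl fun d _ => ?_
  rw [hder, hder, hder, covD_vel_comm h.metric h.isOpen h.smooth h.mapsTo hp (spaceDir a)
      (spaceDir d), covD_vel_comm h.metric h.isOpen h.smooth h.mapsTo hp (spaceDir b)
      (spaceDir d), covD_vel_comm h.metric h.isOpen h.smooth h.mapsTo hp (spaceDir a)
      (spaceDir b)]
  ring

theorem metForm_curvOp_eq_sum_riemannLow {N : ℕ} (g : (Fin N → ℝ) → Fin N → Fin N → ℝ)
    (x B Y A X : Fin N → ℝ) : metForm g x B (curvOp g x Y A X)
      = ∑ μ, ∑ α, ∑ ν, ∑ β, riemannLow g x μ α ν β * B μ * A α * X ν * Y β := by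
  simp only [metForm_apply, curvOp_apply, riemannLow, Finset.mul_sum, Finset.sum_mul]
  refine Finset.sum_congr rfl fun μ _ => ?_
  rw [Finset.sum_comm]
  refine Finset.sum_congr rfl fun α _ => ?_
  rw [Finset.sum_comm]
  refine Finset.sum_congr rfl fun ν _ => ?_
  rw [Finset.sum_comm]
  refine Finset.sum_congr rfl fun β _ => Finset.sum_congr rfl fun l _ => ?_
  ring

end Variation

/-- Lemma 5.6 (1) of the paper, in local coordinates: the first
variation of the extrinsic curvature is
`∂_t (K_t)_{ab}|_{t=0} = f K²_{ab} − f R(n,·,n,·)_{ab} − ϵ (∇^Σ df)_{ab} + (£_X K)_{ab}`. -/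
theorem first_variation_extrinsic_curvature
    (n : ℕ) (hn : 1 ≤ n)
    (U : Set (Fin n → ℝ)) (hU : IsOpen U)
    (V : Set (Fin (n + 1) → ℝ)) (hV : IsOpen V)
    (g : (Fin (n + 1) → ℝ) → Fin (n + 1) → Fin (n + 1) → ℝ)
    (hg : ∀ μ ν, ContDiffOn ℝ (⊤ : ℕ∞) (fun x => g x μ ν) V)
    (hgsym : ∀ x ∈ V, ∀ μ ν, g x μ ν = g x ν μ)
    (hgunit : ∀ x ∈ V, IsUnit (Matrix.of (g x)).det)
    (δ : ℝ) (hδ : 0 < δ)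
    (φ : ℝ → (Fin n → ℝ) → Fin (n + 1) → ℝ)
    (hφ : ∀ μ, ContDiffOn ℝ (⊤ : ℕ∞) (fun q : ℝ × (Fin n → ℝ) => φ q.1 q.2 μ)
      (Set.Ioo (-δ) δ ×ˢ U))
    (hφV : ∀ t ∈ Set.Ioo (-δ) δ, ∀ y ∈ U, φ t y ∈ V)
    (himm : ∀ t ∈ Set.Ioo (-δ) δ, ∀ y ∈ U, ∀ v : Fin n → ℝ,
      (∀ μ, (∑ a, v a * Dphi φ t y a μ) = 0) → v = 0)
    (nrm : ℝ → (Fin n → ℝ) → Fin (n + 1) → ℝ)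
    (hnrm : ∀ μ, ContDiffOn ℝ (⊤ : ℕ∞) (fun q : ℝ × (Fin n → ℝ) => nrm q.1 q.2 μ)
      (Set.Ioo (-δ) δ ×ˢ U))
    (ϵ : ℝ) (hϵ : ϵ = 1 ∨ ϵ = -1)
    (horth : ∀ t ∈ Set.Ioo (-δ) δ, ∀ y ∈ U, ∀ a : Fin n,
      (∑ μ, ∑ ν, g (φ t y) μ ν * nrm t y μ * Dphi φ t y a ν) = 0)
    (hunit : ∀ t ∈ Set.Ioo (-δ) δ, ∀ y ∈ U,
      (∑ μ, ∑ ν, g (φ t y) μ ν * nrm t y μ * nrm t y ν) = ϵ)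
    (f : (Fin n → ℝ) → ℝ) (hf : ContDiffOn ℝ (⊤ : ℕ∞) f U)
    (X : (Fin n → ℝ) → Fin n → ℝ) (hX : ∀ a, ContDiffOn ℝ (⊤ : ℕ∞) (fun y => X y a) U)
    (hdec : ∀ y ∈ U, ∀ μ, deriv (fun t => φ t y μ) 0
      = f y * nrm 0 y μ + ∑ a, X y a * Dphi φ 0 y a μ)
    (hh0 : ∀ y ∈ U, IsUnit (Matrix.of (fun a b => indMet g φ 0 y a b)).det) :
    ∀ y ∈ U, ∀ a b : Fin n,
      deriv (fun t => extK g φ nrm t y a b) 0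
        = f y * (∑ i, ∑ j, extK g φ nrm 0 y a i * indMetInv g φ 0 y i j
              * extK g φ nrm 0 y j b)
          - f y * (∑ μ, ∑ α, ∑ ν, ∑ β, riemannLow g (φ 0 y) μ α ν β
              * nrm 0 y μ * Dphi φ 0 y a α * nrm 0 y ν * Dphi φ 0 y b β)
          - ϵ * (pder (fun z => pder f b z) a y
              - ∑ c, christoffelInd g φ y c a b * pder f c y)
          + ∑ c, (X y c * pder (fun z => extK g φ nrm 0 z a b) c y
              + extK g φ nrm 0 y c b * pder (fun z => X z c) a y
              + extK g φ nrm 0 y a c * pder (fun z => X z c) b y) := by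
  intro y hy a b
  have hI : IsOpen (Set.Ioo (-δ) δ) := isOpen_Ioo
  have h0 : (0 : ℝ) ∈ Set.Ioo (-δ) δ := ⟨neg_lt_zero.2 hδ, hδ⟩
  have hfam : IsNormalFamily g V (Set.Ioo (-δ) δ ×ˢ U)
      (fun q : ℝ × (Fin n → ℝ) => φ q.1 q.2) (fun q => nrm q.1 q.2) spaceDir ϵ :=
    { metric := ⟨hV, hg, hgsym, hgunit⟩
      isOpen := hI.prod hU
      smooth := hφ
      mapsTo := fun q hq => hφV q.1 hq.1 q.2 hq.2
      smooth_normal := hnrm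
      orth := fun q hq a => by
        rw [metForm_apply, ← horth q.1 hq.1 q.2 hq.2 a]
        simp only [Dphi_eq_vel hI hU hφ hq.1 hq.2]
      unit := fun q hq => by rw [metForm_apply, hunit q.1 hq.1 q.2 hq.2] }
  have hK : ∀ t ∈ Set.Ioo (-δ) δ, ∀ z ∈ U, ∀ a b, extK g φ nrm t z a b
      = sndForm g (fun q : ℝ × (Fin n → ℝ) => φ q.1 q.2)
        (fun q : ℝ × (Fin n → ℝ) => nrm q.1 q.2) spaceDir (t, z) a b :=
    fun t ht z hz => extK_eq_sndForm hI hU hφ hnrm ht hz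
  have hp : ((0 : ℝ), y) ∈ Set.Ioo (-δ) δ ×ˢ U := ⟨h0, hy⟩
  have hsnd : ∀ {F : (Fin n → ℝ) → ℝ}, ContDiffOn ℝ (⊤ : ℕ∞) F U →
      ContDiffOn ℝ (⊤ : ℕ∞) (fun q : ℝ × (Fin n → ℝ) => F q.2) (Set.Ioo (-δ) δ ×ˢ U) :=
    fun hF => hF.comp contDiffOn_snd fun q hq => hq.2
  have hpder : ∀ {F : (Fin n → ℝ) → ℝ}, ContDiffOn ℝ (⊤ : ℕ∞) F U → ∀ z ∈ U, ∀ c,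
      pder F c z = fderiv ℝ (fun q : ℝ × (Fin n → ℝ) => F q.2) (0, z) (spaceDir c) :=
    fun hF z hz c => pder_eq_fderiv_prod (t := 0) (F := fun q => _)
      ((hsnd hF).differentiableAt_of_isOpen hfam.isOpen ⟨h0, hz⟩) c
  have hmain := hfam.fderiv_sndForm_of_decomposition (by rcases hϵ with rfl | rfl <;> norm_num)
    (S := {0} ×ˢ U) (Set.prod_mono_left (Set.singleton_subset_iff.2 h0))
    (by
      rintro F G hFG ⟨t, z⟩ ⟨rfl, hz⟩ hF hG c
      rw [spaceDir, ← pder_eq_fderiv_prod hF, ← pder_eq_fderiv_prod hG]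
      exact pder_eq_of_eqOn hU (fun w hw =>
        hFG (show ((0 : ℝ), w) ∈ ({0} : Set ℝ) ×ˢ U from ⟨rfl, hw⟩)) hz c)
    (τ := (1, 0)) (hsnd hf) (X := fun c q => X q.2 c) (fun c => hsnd (hX c))
    (by
      rintro ⟨t, z⟩ ⟨rfl, hz⟩
      ext μ
      have h1 := deriv_eq_fderiv_prod (F := fun q : ℝ × (Fin n → ℝ) => φ q.1 q.2 μ)
        (hfam.smooth.differentiableAt hfam.isOpen (p := (0, z)) ⟨h0, hz⟩ μ)
      rw [vel, ← h1, hdec z hz μ]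
      simp only [Dphi_eq_vel hI hU hφ h0 hz]
      simp)
    (p := (0, y)) ⟨rfl, hy⟩ (H := Matrix.of fun a b => indMet g φ 0 y a b)
    (fun a b => indMet_eq_metForm hI hU hφ h0 hy a b) (hh0 y hy) a b
  have hdK := fun a b => (hfam.contDiffOn_sndForm a b).differentiableAt_of_isOpen hfam.isOpen hp
  have hL : deriv (fun t => extK g φ nrm t y a b) 0
      = fderiv ℝ (fun q => sndForm g (fun q : ℝ × (Fin n → ℝ) => φ q.1 q.2)
        (fun q : ℝ × (Fin n → ℝ) => nrm q.1 q.2) spaceDir q a b) (0, y) (1, 0) := by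
    rw [← deriv_eq_fderiv_prod (hdK a b)]
    refine Filter.EventuallyEq.deriv_eq ?_
    filter_upwards [hI.mem_nhds h0] with t ht using hK t ht y hy a b
  have hKc : ∀ c, pder (fun z => extK g φ nrm 0 z a b) c y
      = fderiv ℝ (fun q => sndForm g (fun q : ℝ × (Fin n → ℝ) => φ q.1 q.2)
        (fun q : ℝ × (Fin n → ℝ) => nrm q.1 q.2) spaceDir q a b) (0, y) (spaceDir c) :=
    fun c => by
      rw [spaceDir, ← pder_eq_fderiv_prod (hdK a b)]
      exact pder_eq_of_eqOn hU (fun z hz => hK 0 h0 z hz a b) hy c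
  have hff : pder (fun z => pder f b z) a y
      = fderiv ℝ (fun q => fderiv ℝ (fun q : ℝ × (Fin n → ℝ) => f q.2) q (spaceDir b)) (0, y)
        (spaceDir a) := by
    rw [pder_eq_of_eqOn hU (fun z hz => hpder hf z hz b) hy]
    exact pder_eq_fderiv_prod (((hsnd hf).fderiv_apply_const hfam.isOpen
      (spaceDir b)).differentiableAt_of_isOpen hfam.isOpen hp) a
  rw [hL, hff]
  simp only [hKc, hK 0 h0 y hy, hpder hf y hy, hpder (hX _) y hy,
    Dphi_eq_vel hI hU hφ h0 hy, christoffelInd_eq_sum hfam hI hU h0 hy]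
  rw [hmain, metForm_curvOp_eq_sum_riemannLow]
  rfl
end
end
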